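/- Let A be an essentially small hereditary abelian category, linear over a finite field F_q, with finite-dimensional Hom and Ext spaces. For any objects A, B, M of A, the two quantities (|(B,M)_A|/ã_B)·√({B,M}/{B,B}) and (|(M,A)_B|/ã_A)·√({M,A}/{A,A}) are equal, and their common value G_{AB}^M satisfies the derived Riedtmann–Peng formula G_{AB}^M = (ã_M · |(A,B)_M| / (ã_A ã_B)) · √({A,B}{M,M}/({A,A}{B,B})). -/

import Mathlib

/-!
Formalization of statements from "ıquantum groups of split type via derived Hall algebras"
(Chen–Lu–Ruan).  We set up 1-periodic complexes, the 1-periodic derived category,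
derived Hall algebras and ıHall algebras.
-/

open CategoryTheory Limits

noncomputable section

universe w w' w'' v u

/-- The type of isomorphism classes of objects of a category. -/
abbrev IsoCls (C : Type u) [Category.{v} C] : Type u :=
  Quotient (CategoryTheory.isIsomorphicSetoid C)

/-- The isomorphism class `[X]` of an object `X`. -/
abbrev mkIso {C : Type u} [Category.{v} C] (X : C) : IsoCls C :=
  Quotient.mk (CategoryTheory.isIsomorphicSetoid C) X

/-- The complex shape whose homological complexes are the `1`-periodic complexes
`(X, d)` with `d : X ⟶ X`, `d ∘ d = 0`. -/
def oneShape : ComplexShape Unit where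
  Rel _ _ := True
  next_eq _ _ := rfl
  prev_eq _ _ := rfl

/-- The category `C₁(A)` of `1`-periodic complexes over `A`. -/
abbrev OnePeriodic (A : Type u) [Category.{v} A] [Abelian A] := HomologicalComplex A oneShape

section OnePeriodicDefs

variable {A : Type u} [Category.{v} A] [Abelian A]

/-- The stalk complex `C_X = (X, 0)`. -/
def stalkC (X : A) : OnePeriodic A where
  X _ := X
  d _ _ := 0
  shape _ _ h := absurd trivial h
  d_comp_d' := by intros; simp

/-- The morphism of stalk complexes induced by a morphism of `A`. -/
def stalkHom {X Y : A} (f : X ⟶ Y) : stalkC X ⟶ stalkC Y where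
  f _ := f
  comm' := by intros; simp [stalkC]

/-- The acyclic complex `K_X = (X ⊕ X, (0 1 // 0 0))`. -/
def KC (X : A) : OnePeriodic A where
  X _ := X ⊞ X
  d _ _ := biprod.snd ≫ biprod.inl
  shape _ _ h := absurd trivial h
  d_comp_d' := by intros; simp

/-- A `1`-periodic complex is acyclic if `ker d = Im d`, i.e. if it is exact. -/
def IsAcyclic (K : OnePeriodic A) : Prop := ∀ i, K.ExactAt i

/-- The cohomology `H(X•) = ker d / Im d` of a `1`-periodic complex. -/
abbrev cohomology (M : OnePeriodic A) : A := M.homology ()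

/-- The underlying object `res(M•)` of a `1`-periodic complex (restriction functor,
forgetting the differential). -/
abbrev resOP (M : OnePeriodic A) : A := M.X ()

/-- The image `Im d` of the differential of a `1`-periodic complex. -/
def imd (M : OnePeriodic A) : A := Limits.image (M.d () ())

/-- The mapping cone of a morphism of `1`-periodic complexes:
`Y ⊕ X` with differential `(d_Y g // 0 -d_X)`. -/
def cone1 {X Y : OnePeriodic A} (g : X ⟶ Y) : OnePeriodic A where
  X _ := Y.X () ⊞ X.X ()
  d _ _ := biprod.desc (Y.d () () ≫ biprod.inl) (g.f () ≫ biprod.inl - X.d () () ≫ biprod.inr)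
  shape _ _ h := absurd trivial h
  d_comp_d' := by
    intros
    apply biprod.hom_ext'
    · rw [biprod.inl_desc_assoc, Category.assoc, biprod.inl_desc, ← Category.assoc,
        HomologicalComplex.d_comp_d, zero_comp, comp_zero]
    · rw [biprod.inr_desc_assoc, Preadditive.sub_comp, Category.assoc, Category.assoc,
        biprod.inl_desc, biprod.inr_desc, comp_zero, ← Category.assoc,
        HomologicalComplex.Hom.comm, Category.assoc, Preadditive.comp_sub, ← Category.assoc,
        ← Category.assoc, HomologicalComplex.d_comp_d, zero_comp, sub_zero, sub_self]

end OnePeriodicDefs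

section Counting

variable {A : Type u} [Category.{v} A] [Abelian A]

/-- `a_X`, the number of automorphisms of `X`. -/
def autCard (X : A) : ℕ := Nat.card (Aut X)

/-- The number of morphisms `X ⟶ Y`. -/
def homCard (X Y : A) : ℕ := Nat.card (X ⟶ Y)

/-- The Hall number `F_{MN}^L`: the number of subobjects `X ⊆ L` with `X ≅ N`
and `L/X ≅ M`. -/
def FHall (M N L : A) : ℕ :=
  Nat.card {X : Subobject L // Nonempty ((X : A) ≅ N) ∧ Nonempty ((cokernel X.arrow) ≅ M)}

/-- The number of short exact sequences `0 → N → L → M → 0` with fixed end terms and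
middle term.  By the Riedtmann–Peng formula, `|Ext¹(M,N)_L| / |Hom(M,N)|` equals
`sesCount M N L / a_L`. -/
def sesCount (M N L : A) : ℕ :=
  Nat.card {p : (N ⟶ L) × (L ⟶ M) // ∃ w : p.1 ≫ p.2 = 0, (ShortComplex.mk p.1 p.2 w).ShortExact}

end Counting

section DerivedCategoryOne

variable {A : Type u} [Category.{v} A] [Abelian A]
  [MorphismProperty.HasLocalization.{w'} (HomologicalComplex.quasiIso A oneShape)]

/-- The `1`-periodic derived category `D₁(A)`: the localization of (the homotopy category of)
`C₁(A)` at the quasi-isomorphisms. -/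
abbrev DOne (A : Type u) [Category.{v} A] [Abelian A]
    [MorphismProperty.HasLocalization.{w'} (HomologicalComplex.quasiIso A oneShape)] :=
  HomologicalComplexUpToQuasiIso A oneShape

/-- The localization functor `C₁(A) ⥤ D₁(A)`. -/
abbrev QD : OnePeriodic A ⥤ DOne A := HomologicalComplexUpToQuasiIso.Q

/-- The number of morphisms `A ⟶ B` in `D₁(A)` (for stalk complexes). -/
def homD1Card (X Y : A) : ℕ := Nat.card (QD.obj (stalkC X) ⟶ QD.obj (stalkC Y))

/-- `ã_X`, the number of automorphisms of `X` in `D₁(A)`. -/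
def autD1 (X : A) : ℕ := Nat.card (Aut (QD.obj (stalkC X)))

/-- `{X,Y} = 1 / |Hom_{D₁(A)}(X,Y)|`. -/
def braceD (X Y : A) : ℝ := ((homD1Card X Y : ℝ))⁻¹

/-- `M` is a cone of the morphism `f : X ⟶ Y` of `D₁(A)`: writing `f` as a right fraction
`Q(s)⁻¹ ≫ Q(g)` with `s` a quasi-isomorphism of `1`-periodic complexes, the mapping cone of
`g` is isomorphic to `M` in `D₁(A)`. -/
def IsConeOf {X Y : A} (f : QD.obj (stalkC X) ⟶ QD.obj (stalkC Y)) (M : A) : Prop :=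
  ∃ (Z : OnePeriodic A) (s : Z ⟶ stalkC X) (g : Z ⟶ stalkC Y),
    HomologicalComplex.quasiIso A oneShape s ∧ QD.map s ≫ f = QD.map g ∧
      Nonempty (QD.obj (cone1 g) ≅ QD.obj (stalkC M))

/-- `|(X,Y)_M|`, the number of morphisms `f ∈ Hom_{D₁(A)}(X,Y)` with cone isomorphic
to `M`. -/
def coneCount (X Y M : A) : ℕ :=
  Nat.card {f : QD.obj (stalkC X) ⟶ QD.obj (stalkC Y) // IsConeOf f M}

/-- The derived Hall number `G_{XY}^M`, given by the derived Riedtmann–Peng formula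
`G_{XY}^M = (ã_M |(X,Y)_M| / (ã_X ã_Y)) √({X,Y}{M,M}/({X,X}{Y,Y}))`. -/
def Gnum (X Y M : A) : ℝ :=
  ((autD1 M : ℝ) * (coneCount X Y M : ℝ)) / ((autD1 X : ℝ) * (autD1 Y : ℝ)) *
    Real.sqrt ((braceD X Y * braceD M M) / (braceD X X * braceD Y Y))

end DerivedCategoryOne

namespace OnePeriodic

open CategoryTheory.Pretriangulated

variable {A : Type u} [Category.{v} A] [Abelian A]

/-- A homotopy between maps of one-periodic complexes, given by a single map
between the underlying objects. -/
def mkHomotopy {X Y : OnePeriodic A} {f g : X ⟶ Y} (s : X.X () ⟶ Y.X ())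
    (h : f.f () = X.d () () ≫ s + s ≫ Y.d () () + g.f ()) : Homotopy f g where
  hom _ _ := s
  zero _ _ h := absurd trivial h
  comm i := by
    rw [dNext_eq _ (show oneShape.Rel () () from trivial), prevD_eq _ (show oneShape.Rel () () from trivial)]
    exact h

lemma homotopy_comm {X Y : OnePeriodic A} {f g : X ⟶ Y} (h : Homotopy f g) :
    f.f () = X.d () () ≫ h.hom () () + h.hom () () ≫ Y.d () () + g.f () := by
  have := h.comm ()
  rwa [dNext_eq _ (show oneShape.Rel () () from trivial), prevD_eq _ (show oneShape.Rel () () from trivial)] at this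

lemma hom_ext {X Y : OnePeriodic A} {f g : X ⟶ Y} (h : f.f () = g.f ()) : f = g :=
  HomologicalComplex.hom_ext _ _ (fun _ => h)

/-- Construct an isomorphism of one-periodic complexes from an isomorphism of the underlying
objects. -/
@[simps!]
def mkIsoOfX {X Y : OnePeriodic A} (e : X.X () ≅ Y.X ())
    (h : e.hom ≫ Y.d () () = X.d () () ≫ e.hom) : X ≅ Y :=
  HomologicalComplex.Hom.isoOfComponents (fun _ => e) (fun _ _ _ => h)

variable (A) in
/-- The shift functor by `n` multiplies the differential by `(-1)^n`. -/
@[simps]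
def shiftFun (n : ℤ) : OnePeriodic A ⥤ OnePeriodic A where
  obj K :=
    { X := fun i => K.X i
      d := fun i j => n.negOnePow • K.d i j
      d_comp_d' := by
        intros
        simp only [Linear.comp_units_smul, Linear.units_smul_comp,
          HomologicalComplex.d_comp_d, smul_zero]
      shape := fun i j hij => absurd trivial hij }
  map φ :=
    { f := fun i => φ.f i
      comm' := by
        intros
        simp only [Linear.comp_units_smul, HomologicalComplex.Hom.comm, Linear.units_smul_comp] }
  map_id := by intros; rfl
  map_comp := by intros; rfl

variable (A) in
/-- The shift functor by zero identifies to the identity functor. -/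
def shiftFunZero : shiftFun A 0 ≅ 𝟭 _ :=
  NatIso.ofComponents (fun K => mkIsoOfX (X := (shiftFun A 0).obj K) (Iso.refl (K.X ()))
    ((Category.id_comp _).trans
      ((one_smul _ (K.d () ())).symm.trans (Category.comp_id _).symm)))
    (fun _ => hom_ext ((Category.comp_id _).trans (Category.id_comp _).symm))

variable (A) in
/-- The compatibility of the shift functors with the addition of integers. -/
def shiftFunAdd (a b : ℤ) : shiftFun A (a + b) ≅ shiftFun A a ⋙ shiftFun A b :=
  NatIso.ofComponents (fun K => mkIsoOfX (X := (shiftFun A (a + b)).obj K)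
    (Y := (shiftFun A b).obj ((shiftFun A a).obj K)) (Iso.refl (K.X ()))
    ((Category.id_comp _).trans ((show b.negOnePow • a.negOnePow • K.d () () =
      (a + b).negOnePow • K.d () () by rw [smul_smul, Int.negOnePow_add, mul_comm]).trans
      (Category.comp_id _).symm)))
    (fun _ => hom_ext ((Category.comp_id _).trans (Category.id_comp _).symm))

lemma shiftFun_eqToHom {m n : ℤ} (h : m = n) (X : OnePeriodic A) :
    (eqToHom (by rw [h]) : (shiftFun A m).obj X ⟶ (shiftFun A n).obj X).f () = 𝟙 (X.X ()) := by
  subst h; rfl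

instance : HasShift (OnePeriodic A) ℤ := hasShiftMk _ _
  { F := shiftFun A
    zero := shiftFunZero A
    add := shiftFunAdd A
    assoc_hom_app m n p X := hom_ext (by
      refine Eq.trans ?_ (congrArg (· ≫ 𝟙 (X.X ()) ≫ 𝟙 (X.X ()))
        (shiftFun_eqToHom (add_assoc m n p) X)).symm
      exact (Category.id_comp (𝟙 (X.X ()) ≫ 𝟙 (X.X ()))).symm.trans rfl)
    zero_add_hom_app n X := hom_ext (by
      refine Eq.trans ?_ (congrArg (· ≫ 𝟙 (X.X ()))
        (shiftFun_eqToHom (zero_add n) X)).symm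
      exact (Category.id_comp (𝟙 (X.X ()))).symm)
    add_zero_hom_app n X := hom_ext (by
      refine Eq.trans ?_ (congrArg (· ≫ 𝟙 (X.X ()))
        (shiftFun_eqToHom (add_zero n) X)).symm
      exact (Category.id_comp (𝟙 (X.X ()))).symm) }

end OnePeriodic

/-- The homotopy category of one-periodic complexes. -/
abbrev KOne (A : Type u) [Category.{v} A] [Abelian A] := HomotopyCategory A oneShape

namespace OnePeriodic

open CategoryTheory.Pretriangulated

variable {A : Type u} [Category.{v} A] [Abelian A]

instance (n : ℤ) : (shiftFunctor (OnePeriodic A) n).Additive where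
  map_add := hom_ext rfl

instance : (homotopic A oneShape).IsCompatibleWithShift ℤ where
  condition n X Y f g := fun ⟨h⟩ => ⟨mkHomotopy (X := X⟦n⟧) (Y := Y⟦n⟧)
    (f := f⟦n⟧') (g := g⟦n⟧') (n.negOnePow • h.hom () ()) (by
      refine (homotopy_comm h).trans (Eq.symm ?_)
      have key (s : X.X () ⟶ Y.X ()) : (n.negOnePow • X.d () ()) ≫ (n.negOnePow • s) +
        (n.negOnePow • s) ≫ (n.negOnePow • Y.d () ()) + g.f () =
        X.d () () ≫ s + s ≫ Y.d () () + g.f () := by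
        simp only [Linear.units_smul_comp, Linear.comp_units_smul, smul_smul,
          Int.units_mul_self, one_smul]
      exact key _)⟩

instance : HasShift (KOne A) ℤ :=
  inferInstanceAs (HasShift (Quotient (homotopic A oneShape)) ℤ)

instance : (HomotopyCategory.quotient A oneShape).CommShift ℤ :=
  Quotient.functor_commShift (homotopic A oneShape) ℤ

instance (n : ℤ) : (shiftFunctor (KOne A) n).Additive := by
  have : (HomotopyCategory.quotient A oneShape ⋙ shiftFunctor (KOne A) n).Additive :=
    Functor.additive_of_iso ((HomotopyCategory.quotient A oneShape).commShiftIso n)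
  apply Functor.additive_of_full_essSurj_comp (HomotopyCategory.quotient _ _)

variable (A) in
/-- The quotient functor to the homotopy category. -/
abbrev QK : OnePeriodic A ⥤ KOne A := HomotopyCategory.quotient A oneShape

@[simp]
lemma shift_d (X : OnePeriodic A) (n : ℤ) :
    (X⟦n⟧).d () () = n.negOnePow • X.d () () := rfl

lemma shift_one_d (X : OnePeriodic A) :
    (X⟦(1 : ℤ)⟧).d () () = - X.d () () :=
  (shift_d X 1).trans (by rw [Int.negOnePow_one, Units.neg_smul, one_smul])

@[simp]
lemma shift_map_f {X Y : OnePeriodic A} (f : X ⟶ Y) (n : ℤ) : (f⟦n⟧').f () = f.f () := rfl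

lemma shiftFunctorAdd'_hom_f (X : OnePeriodic A) (a b c : ℤ) (h : a + b = c) :
    ((shiftFunctorAdd' (OnePeriodic A) a b c h).hom.app X).f () = 𝟙 (X.X ()) := by
  subst h
  rw [shiftFunctorAdd'_eq_shiftFunctorAdd]
  rfl

lemma shiftFunctorAdd'_inv_f (X : OnePeriodic A) (a b c : ℤ) (h : a + b = c) :
    ((shiftFunctorAdd' (OnePeriodic A) a b c h).inv.app X).f () = 𝟙 (X.X ()) := by
  subst h
  rw [shiftFunctorAdd'_eq_shiftFunctorAdd]
  rfl

lemma shiftFunctorComm_hom_f (X : OnePeriodic A) (a b : ℤ) :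
    ((shiftFunctorComm (OnePeriodic A) a b).hom.app X).f () = 𝟙 (X.X ()) := by
  rw [shiftFunctorComm_eq _ _ _ _ rfl]
  refine (congrArg₂ (· ≫ ·) (shiftFunctorAdd'_inv_f X a b _ rfl)
    (shiftFunctorAdd'_hom_f X b a _ (add_comm b a))).trans (Category.comp_id (𝟙 (X.X ())))

/-- The inclusion of the target in the mapping cone. -/
def coneInl {X Y : OnePeriodic A} (φ : X ⟶ Y) : Y ⟶ cone1 φ where
  f _ := biprod.inl
  comm' _ _ _ := biprod.inl_desc _ _

/-- The projection of the mapping cone to the shift of the source. -/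
def coneSnd {X Y : OnePeriodic A} (φ : X ⟶ Y) : cone1 φ ⟶ X⟦(1 : ℤ)⟧ where
  f _ := (biprod.snd : Y.X () ⊞ X.X () ⟶ X.X ())
  comm' _ _ _ := by
    refine (congrArg (biprod.snd ≫ ·) (shift_one_d X)).trans ?_
    change biprod.snd ≫ (- X.d () ()) = biprod.desc (Y.d () () ≫ biprod.inl)
        (φ.f () ≫ biprod.inl - X.d () () ≫ biprod.inr) ≫ biprod.snd
    ext <;> simp

/-- The triangle attached to a mapping cone. -/
@[simps!]
def coneTri {X Y : OnePeriodic A} (φ : X ⟶ Y) : Triangle (OnePeriodic A) :=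
  Triangle.mk φ (coneInl φ) (coneSnd φ)

/-- The map induced on cones by a square which commutes up to homotopy. -/
def coneMap {X Y X' Y' : OnePeriodic A} {φ : X ⟶ Y} {φ' : X' ⟶ Y'} (a : X ⟶ X') (b : Y ⟶ Y')
    (h : Homotopy (φ ≫ b) (a ≫ φ')) : cone1 φ ⟶ cone1 φ' where
  f _ := biprod.desc (b.f () ≫ biprod.inl) (h.hom () () ≫ biprod.inl + a.f () ≫ biprod.inr)
  comm' _ _ _ := by
    have h1 := homotopy_comm h
    simp only [HomologicalComplex.comp_f] at h1
    change biprod.desc (b.f () ≫ biprod.inl)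
      (h.hom () () ≫ biprod.inl + a.f () ≫ biprod.inr) ≫
      biprod.desc (Y'.d () () ≫ biprod.inl) (φ'.f () ≫ biprod.inl - X'.d () () ≫ biprod.inr) =
      biprod.desc (Y.d () () ≫ biprod.inl) (φ.f () ≫ biprod.inl - X.d () () ≫ biprod.inr) ≫
      biprod.desc (b.f () ≫ biprod.inl) (h.hom () () ≫ biprod.inl + a.f () ≫ biprod.inr)
    apply biprod.hom_ext' <;> apply biprod.hom_ext
    · simp
    · simp
    · simp [h1]
      abel
    · simp

lemma coneInl_coneMap {X Y X' Y' : OnePeriodic A} {φ : X ⟶ Y} {φ' : X' ⟶ Y'}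
    (a : X ⟶ X') (b : Y ⟶ Y') (h : Homotopy (φ ≫ b) (a ≫ φ')) :
    coneInl φ ≫ coneMap a b h = b ≫ coneInl φ' :=
  hom_ext (biprod.inl_desc _ _)

lemma coneMap_coneSnd {X Y X' Y' : OnePeriodic A} {φ : X ⟶ Y} {φ' : X' ⟶ Y'}
    (a : X ⟶ X') (b : Y ⟶ Y') (h : Homotopy (φ ≫ b) (a ≫ φ')) :
    coneMap a b h ≫ coneSnd φ' = coneSnd φ ≫ a⟦(1 : ℤ)⟧' :=
  hom_ext (by
    change biprod.desc (b.f () ≫ biprod.inl)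
      (h.hom () () ≫ biprod.inl + a.f () ≫ biprod.inr) ≫ biprod.snd =
      biprod.snd ≫ a.f ()
    ext <;> simp)

/-- The cone of an identity is contractible. -/
def coneIdHomotopy (X : OnePeriodic A) : Homotopy (𝟙 (cone1 (𝟙 X))) 0 :=
  mkHomotopy (X := cone1 (𝟙 X)) (Y := cone1 (𝟙 X)) (biprod.fst ≫ biprod.inr) (by
    have key : 𝟙 (X.X () ⊞ X.X ()) = biprod.desc (X.d () () ≫ biprod.inl)
      (𝟙 (X.X ()) ≫ biprod.inl - X.d () () ≫ biprod.inr) ≫ biprod.fst ≫ biprod.inr +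
      (biprod.fst ≫ biprod.inr) ≫ biprod.desc (X.d () () ≫ biprod.inl)
      (𝟙 (X.X ()) ≫ biprod.inl - X.d () () ≫ biprod.inr) := by
      apply biprod.hom_ext' <;> apply biprod.hom_ext <;> simp
    exact key.trans (add_zero _).symm)

end OnePeriodic

namespace OnePeriodic

open CategoryTheory.Pretriangulated

variable {A : Type u} [Category.{v} A] [Abelian A]

/-- The matrix of the differential of a mapping cone. -/
def coneD {U V : A} (a : V ⟶ V) (f : U ⟶ V) (b : U ⟶ U) : V ⊞ U ⟶ V ⊞ U :=
  biprod.desc (a ≫ biprod.inl) (f ≫ biprod.inl - b ≫ biprod.inr)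

@[simp]
lemma inl_coneD {U V : A} (a : V ⟶ V) (f : U ⟶ V) (b : U ⟶ U) :
    biprod.inl ≫ coneD a f b = a ≫ biprod.inl := biprod.inl_desc _ _

@[simp]
lemma inr_coneD {U V : A} (a : V ⟶ V) (f : U ⟶ V) (b : U ⟶ U) :
    biprod.inr ≫ coneD a f b = f ≫ biprod.inl - b ≫ biprod.inr := biprod.inr_desc _ _

@[simp]
lemma coneD_fst {U V : A} (a : V ⟶ V) (f : U ⟶ V) (b : U ⟶ U) :
    coneD a f b ≫ biprod.fst = biprod.fst ≫ a + biprod.snd ≫ f := by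
  apply biprod.hom_ext' <;> simp [coneD]

@[simp]
lemma coneD_snd {U V : A} (a : V ⟶ V) (f : U ⟶ V) (b : U ⟶ U) :
    coneD a f b ≫ biprod.snd = - biprod.snd ≫ b := by
  apply biprod.hom_ext' <;> simp [coneD]

lemma coneD_fst_assoc {U V W : A} (a : V ⟶ V) (f : U ⟶ V) (b : U ⟶ U) (g : V ⟶ W) :
    coneD a f b ≫ biprod.fst ≫ g = biprod.fst ≫ a ≫ g + biprod.snd ≫ f ≫ g := by
  rw [← Category.assoc, coneD_fst, Preadditive.add_comp, Category.assoc, Category.assoc]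

section

variable {X Y : OnePeriodic A} (φ : X ⟶ Y)

/-- The map from the shift of `X` to the cone of `Y ⟶ cone1 φ`. -/
def rotHom : X⟦(1 : ℤ)⟧ ⟶ cone1 (coneInl φ) where
  f _ := (biprod.lift biprod.inr (-φ.f ()) : X.X () ⟶ (Y.X () ⊞ X.X ()) ⊞ Y.X ())
  comm' _ _ _ := by
    have h := φ.comm () ()
    refine Eq.trans ?_ (congrArg (· ≫ (biprod.lift biprod.inr (-φ.f ()) :
      X.X () ⟶ (Y.X () ⊞ X.X ()) ⊞ Y.X ())) (shift_one_d X)).symm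
    change biprod.lift biprod.inr (-φ.f ()) ≫ coneD (coneD (Y.d () ()) (φ.f ()) (X.d () ())) biprod.inl (Y.d () ()) =
      (- X.d () ()) ≫ (biprod.lift biprod.inr (-φ.f ()) : X.X () ⟶ (Y.X () ⊞ X.X ()) ⊞ Y.X ())
    apply biprod.hom_ext
    · apply biprod.hom_ext <;> simp
    · simp [h]

/-- The map from the cone of `Y ⟶ cone1 φ` to the shift of `X`. -/
def rotInv : cone1 (coneInl φ) ⟶ X⟦(1 : ℤ)⟧ where
  f _ := (biprod.fst ≫ biprod.snd : (Y.X () ⊞ X.X ()) ⊞ Y.X () ⟶ X.X ())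
  comm' _ _ _ := by
    refine (congrArg ((biprod.fst ≫ biprod.snd : (Y.X () ⊞ X.X ()) ⊞ Y.X () ⟶ X.X ()) ≫ ·)
      (shift_one_d X)).trans ?_
    change (biprod.fst ≫ biprod.snd) ≫ (- X.d () ()) = coneD (coneD (Y.d () ()) (φ.f ()) (X.d () ())) biprod.inl (Y.d () ()) ≫
      biprod.fst ≫ biprod.snd
    simp [coneD_fst_assoc]

lemma rotHom_rotInv : rotHom φ ≫ rotInv φ = 𝟙 _ :=
  hom_ext (by
    change biprod.lift biprod.inr (-φ.f ()) ≫ biprod.fst ≫ biprod.snd = 𝟙 (X.X ())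
    simp)

/-- The composition `rotInv φ ≫ rotHom φ` is homotopic to the identity. -/
def rotHomotopy : Homotopy (rotInv φ ≫ rotHom φ) (𝟙 _) :=
  mkHomotopy (X := cone1 (coneInl φ)) (Y := cone1 (coneInl φ))
    (- (biprod.fst ≫ biprod.fst) ≫ biprod.inr) (by
    have key : (biprod.fst ≫ biprod.snd) ≫ biprod.lift biprod.inr (-φ.f ()) = coneD (coneD (Y.d () ()) (φ.f ()) (X.d () ())) biprod.inl (Y.d () ()) ≫
      (- (biprod.fst ≫ biprod.fst) ≫ biprod.inr) +
      (- (biprod.fst ≫ biprod.fst) ≫ biprod.inr) ≫ coneD (coneD (Y.d () ()) (φ.f ()) (X.d () ())) biprod.inl (Y.d () ()) +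
      𝟙 ((Y.X () ⊞ X.X ()) ⊞ Y.X ()) := by
      apply biprod.hom_ext
      · apply biprod.hom_ext <;> simp
      · simp [coneD_fst_assoc]
        abel
    exact key)

/-- The homotopy equivalence between the shift of `X` and the cone of `Y ⟶ cone1 φ`. -/
def rotEquiv : HomotopyEquiv (X⟦(1 : ℤ)⟧) (cone1 (coneInl φ)) where
  hom := rotHom φ
  inv := rotInv φ
  homotopyHomInvId := Homotopy.ofEq (rotHom_rotInv φ)
  homotopyInvHomId := rotHomotopy φ

lemma coneInl_rotInv : coneInl (coneInl φ) ≫ rotInv φ = coneSnd φ :=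
  hom_ext (by
    change (biprod.inl : _ ⟶ (Y.X () ⊞ X.X ()) ⊞ Y.X ()) ≫ biprod.fst ≫ biprod.snd = biprod.snd
    simp)

lemma rotHom_coneSnd : rotHom φ ≫ coneSnd (coneInl φ) = - φ⟦(1 : ℤ)⟧' :=
  hom_ext (by
    change biprod.lift biprod.inr (-φ.f ()) ≫ biprod.snd = - φ.f ()
    simp)

/-- The image of a cone triangle in the homotopy category. -/
abbrev coneTriK : Triangle (KOne A) := (QK A).mapTriangle.obj (coneTri φ)

/-- The rotation of a cone triangle is a cone triangle. -/
def rotIso : (coneTriK φ).rotate ≅ coneTriK (coneInl φ) :=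
  Triangle.isoMk _ _ (Iso.refl _) (Iso.refl _)
    (((QK A).commShiftIso (1 : ℤ)).symm.app X ≪≫
      HomotopyCategory.isoOfHomotopyEquiv (rotEquiv φ))
    ((Category.comp_id _).trans (Category.id_comp _).symm)
    (by
      rw [← Iso.eq_comp_inv]
      change (QK A).map (coneSnd φ) ≫ ((QK A).commShiftIso (1 : ℤ)).hom.app X =
        (𝟙 _ ≫ (QK A).map (coneInl (coneInl φ))) ≫ (QK A).map (rotInv φ) ≫
          ((QK A).commShiftIso (1 : ℤ)).hom.app X
      rw [Category.id_comp, ← Functor.map_comp_assoc, coneInl_rotInv])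
    (by
      change (-((QK A).map φ)⟦(1 : ℤ)⟧') ≫ (𝟙 ((QK A).obj Y))⟦(1 : ℤ)⟧' =
        (((QK A).commShiftIso (1 : ℤ)).inv.app X ≫ (QK A).map (rotHom φ)) ≫
          (QK A).map (coneSnd (coneInl φ)) ≫ ((QK A).commShiftIso (1 : ℤ)).hom.app Y
      rw [CategoryTheory.Functor.map_id, Category.comp_id, Category.assoc,
        ← Functor.map_comp_assoc, rotHom_coneSnd, Functor.map_neg, Preadditive.neg_comp,
        Functor.commShiftIso_hom_naturality, Preadditive.comp_neg, Iso.inv_hom_id_app_assoc])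

lemma coneD_smul {U V : A} (a : V ⟶ V) (f : U ⟶ V) (b : U ⟶ U) (ε : ℤˣ) :
    biprod.map (ε • 𝟙 V) (𝟙 U) ≫ coneD (ε • a) f (ε • b) =
      (ε • coneD a f b) ≫ biprod.map (ε • 𝟙 V) (𝟙 U) := by
  apply biprod.hom_ext' <;>
    simp [coneD, smul_smul, smul_sub, Linear.units_smul_comp, Linear.comp_units_smul]

lemma biprod_smul_involutive {U V : A} (ε : ℤˣ) :
    biprod.map (ε • 𝟙 V) (𝟙 U) ≫ biprod.map (ε • 𝟙 V) (𝟙 U) = 𝟙 (V ⊞ U) := by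
  apply biprod.hom_ext' <;>
    simp [smul_smul, Linear.units_smul_comp, Linear.comp_units_smul]

/-- The shift of a cone is the cone of the shift. -/
def shiftConeIso (n : ℤ) : (cone1 φ)⟦n⟧ ≅ cone1 (φ⟦n⟧') :=
  mkIsoOfX (X := (cone1 φ)⟦n⟧) (Y := cone1 (φ⟦n⟧'))
    { hom := (biprod.map (n.negOnePow • 𝟙 (Y.X ())) (𝟙 (X.X ())) : Y.X () ⊞ X.X () ⟶ _)
      inv := (biprod.map (n.negOnePow • 𝟙 (Y.X ())) (𝟙 (X.X ())) : Y.X () ⊞ X.X () ⟶ _)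
      hom_inv_id := biprod_smul_involutive _
      inv_hom_id := biprod_smul_involutive _ }
    (coneD_smul _ _ _ _)

/-- A unit of `ℤ` acts on an object by an automorphism. -/
def unitIso {C : Type*} [Category C] [Preadditive C] (X : C) (ε : ℤˣ) : X ≅ X where
  hom := ε • 𝟙 X
  inv := ε • 𝟙 X
  hom_inv_id := by
    rw [Linear.units_smul_comp, Linear.comp_units_smul, smul_smul, Int.units_mul_self, one_smul,
      Category.comp_id]
  inv_hom_id := by
    rw [Linear.units_smul_comp, Linear.comp_units_smul, smul_smul, Int.units_mul_self, one_smul,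
      Category.comp_id]

/-- The shift of a cone triangle is a cone triangle. -/
def shiftTriIso (n : ℤ) :
    (Triangle.shiftFunctor (OnePeriodic A) n).obj (coneTri φ) ≅ coneTri (φ⟦n⟧') :=
  Triangle.isoMk _ _ (unitIso _ n.negOnePow) (Iso.refl _) (shiftConeIso φ n)
    (hom_ext (by
      change (n.negOnePow • φ.f ()) ≫ 𝟙 (Y.X ()) = (n.negOnePow • 𝟙 (X.X ())) ≫ φ.f ()
      rw [Category.comp_id, Linear.units_smul_comp, Category.id_comp]))
    (hom_ext (by
      change (n.negOnePow • (biprod.inl : _ ⟶ Y.X () ⊞ X.X ())) ≫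
        biprod.map (n.negOnePow • 𝟙 (Y.X ())) (𝟙 (X.X ())) = 𝟙 (Y.X ()) ≫ biprod.inl
      simp [smul_smul, Linear.units_smul_comp]))
    (hom_ext (by
      refine (congrArg (fun t => (n.negOnePow • ((biprod.snd : Y.X () ⊞ X.X () ⟶ _) ≫ t)) ≫
        (n.negOnePow • 𝟙 (X.X ()))) (shiftFunctorComm_hom_f X 1 n)).trans ?_
      change (n.negOnePow • ((biprod.snd : Y.X () ⊞ X.X () ⟶ _) ≫ 𝟙 _)) ≫
        (n.negOnePow • 𝟙 (X.X ())) = biprod.map (n.negOnePow • 𝟙 (Y.X ())) (𝟙 (X.X ())) ≫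
          biprod.snd
      simp [smul_smul, Linear.comp_units_smul]))

end

variable (A) in
/-- The distinguished triangles of the homotopy category: those isomorphic to a cone triangle. -/
def distTri : Set (Triangle (KOne A)) :=
  {T | ∃ (X Y : OnePeriodic A) (φ : X ⟶ Y), Nonempty (T ≅ coneTriK φ)}

lemma distTri_of_iso (T₁ : Triangle (KOne A)) (h : T₁ ∈ distTri A) (T₂ : Triangle (KOne A))
    (e : T₂ ≅ T₁) : T₂ ∈ distTri A := by
  obtain ⟨X, Y, f, ⟨e'⟩⟩ := h
  exact ⟨X, Y, f, ⟨e ≪≫ e'⟩⟩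

lemma contractible_distTri (X : KOne A) : contractibleTriangle X ∈ distTri A := by
  obtain ⟨X, rfl⟩ := HomotopyCategory.quotient_obj_surjective X
  have h : IsZero ((QK A).obj (cone1 (𝟙 X))) :=
    (HomotopyCategory.isZero_quotient_obj_iff _).2 ⟨coneIdHomotopy X⟩
  refine ⟨X, X, 𝟙 X, ⟨Triangle.isoMk _ _ (Iso.refl _) (Iso.refl _) h.isoZero.symm ?_
    (h.eq_of_tgt _ _) ?_⟩⟩
  · change 𝟙 ((QK A).obj X) ≫ 𝟙 _ = 𝟙 _ ≫ (QK A).map (𝟙 X)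
    rw [CategoryTheory.Functor.map_id]
  · exact (isZero_zero _).eq_of_src _ _

lemma exists_distTri {X Y : KOne A} (f : X ⟶ Y) :
    ∃ (Z : KOne A) (g : Y ⟶ Z) (h : Z ⟶ X⟦(1 : ℤ)⟧), Triangle.mk f g h ∈ distTri A := by
  obtain ⟨X, rfl⟩ := HomotopyCategory.quotient_obj_surjective X
  obtain ⟨Y, rfl⟩ := HomotopyCategory.quotient_obj_surjective Y
  obtain ⟨f, rfl⟩ := (QK A).map_surjective f
  exact ⟨_, _, _, ⟨_, _, f, ⟨Iso.refl _⟩⟩⟩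

lemma rotate_distTri' (T : Triangle (KOne A)) (h : T ∈ distTri A) : T.rotate ∈ distTri A := by
  obtain ⟨X, Y, φ, ⟨e⟩⟩ := h
  exact ⟨_, _, _, ⟨(rotate _).mapIso e ≪≫ rotIso φ⟩⟩

lemma shift_distTri (T : Triangle (KOne A)) (h : T ∈ distTri A) (n : ℤ) :
    (Triangle.shiftFunctor _ n).obj T ∈ distTri A := by
  obtain ⟨X, Y, φ, ⟨e⟩⟩ := h
  exact ⟨_, _, _, ⟨Functor.mapIso _ e ≪≫ ((QK A).mapTriangle.commShiftIso n).symm.app _ ≪≫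
    (QK A).mapTriangle.mapIso (shiftTriIso φ n)⟩⟩

lemma invRotate_distTri (T : Triangle (KOne A)) (h : T ∈ distTri A) : T.invRotate ∈ distTri A :=
  distTri_of_iso _ (shift_distTri _ (rotate_distTri' _ (rotate_distTri' _ h)) _) _
    ((invRotateIsoRotateRotateShiftFunctorNegOne _).app T)

lemma rotate_distTri (T : Triangle (KOne A)) : T ∈ distTri A ↔ T.rotate ∈ distTri A := by
  constructor
  · exact rotate_distTri' T
  · intro hT
    exact distTri_of_iso _ (invRotate_distTri T.rotate hT) _ ((triangleRotation _).unitIso.app T)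

/-- The morphism of cone triangles induced by a square commuting up to homotopy. -/
def coneTriKMap {X Y X' Y' : OnePeriodic A} {φ : X ⟶ Y} {φ' : X' ⟶ Y'} (a : X ⟶ X') (b : Y ⟶ Y')
    (h : Homotopy (φ ≫ b) (a ≫ φ')) : coneTriK φ ⟶ coneTriK φ' where
  hom₁ := (QK A).map a
  hom₂ := (QK A).map b
  hom₃ := (QK A).map (coneMap a b h)
  comm₁ := by
    change (QK A).map φ ≫ (QK A).map b = (QK A).map a ≫ (QK A).map φ'
    rw [← Functor.map_comp, ← Functor.map_comp]
    exact HomotopyCategory.eq_of_homotopy _ _ h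
  comm₂ := by
    change (QK A).map (coneInl φ) ≫ (QK A).map (coneMap a b h) =
      (QK A).map b ≫ (QK A).map (coneInl φ')
    rw [← Functor.map_comp, ← Functor.map_comp, coneInl_coneMap]
  comm₃ := by
    change ((QK A).map (coneSnd φ) ≫ ((QK A).commShiftIso (1 : ℤ)).hom.app X) ≫
      ((QK A).map a)⟦(1 : ℤ)⟧' = (QK A).map (coneMap a b h) ≫
        (QK A).map (coneSnd φ') ≫ ((QK A).commShiftIso (1 : ℤ)).hom.app X'
    rw [← Functor.map_comp_assoc, coneMap_coneSnd, Functor.map_comp, Category.assoc,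
      Category.assoc, Functor.commShiftIso_hom_naturality]

lemma complete_distTri (T₁ T₂ : Triangle (KOne A)) (h₁ : T₁ ∈ distTri A) (h₂ : T₂ ∈ distTri A)
    (a : T₁.obj₁ ⟶ T₂.obj₁) (b : T₁.obj₂ ⟶ T₂.obj₂) (fac : T₁.mor₁ ≫ b = a ≫ T₂.mor₁) :
    ∃ (c : T₁.obj₃ ⟶ T₂.obj₃), T₁.mor₂ ≫ c = b ≫ T₂.mor₂ ∧
      T₁.mor₃ ≫ a⟦(1 : ℤ)⟧' = c ≫ T₂.mor₃ := by
  obtain ⟨X₁, Y₁, φ₁, ⟨e₁⟩⟩ := h₁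
  obtain ⟨X₂, Y₂, φ₂, ⟨e₂⟩⟩ := h₂
  let p₁ : (QK A).obj X₁ ⟶ T₁.obj₁ := e₁.inv.hom₁
  let q₁ : (QK A).obj Y₁ ⟶ T₁.obj₂ := e₁.inv.hom₂
  let p₂ : T₂.obj₁ ⟶ (QK A).obj X₂ := e₂.hom.hom₁
  let q₂ : T₂.obj₂ ⟶ (QK A).obj Y₂ := e₂.hom.hom₂
  obtain ⟨a', ha'⟩ := (QK A).map_surjective (p₁ ≫ a ≫ p₂)
  obtain ⟨b', hb'⟩ := (QK A).map_surjective (q₁ ≫ b ≫ q₂)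
  have H : Homotopy (φ₁ ≫ b') (a' ≫ φ₂) := HomotopyCategory.homotopyOfEq _ _ (by
    have c₁ : (QK A).map φ₁ ≫ q₁ = p₁ ≫ T₁.mor₁ := e₁.inv.comm₁
    have c₂ : T₂.mor₁ ≫ q₂ = p₂ ≫ (QK A).map φ₂ := e₂.hom.comm₁
    rw [Functor.map_comp, Functor.map_comp, ha', hb', reassoc_of% c₁, reassoc_of% fac, c₂,
      Category.assoc, Category.assoc])
  let γ : T₁ ⟶ T₂ := e₁.hom ≫ coneTriKMap a' b' H ≫ e₂.inv
  have hb : γ.hom₂ = b := by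
    let r : T₁.obj₂ ⟶ (QK A).obj Y₁ := e₁.hom.hom₂
    let r' : (QK A).obj Y₂ ⟶ T₂.obj₂ := e₂.inv.hom₂
    have h₁ : r ≫ q₁ = 𝟙 _ := e₁.hom_inv_id_triangle_hom₂
    have h₂ : q₂ ≫ r' = 𝟙 _ := e₂.hom_inv_id_triangle_hom₂
    change r ≫ (QK A).map b' ≫ r' = b
    rw [hb', Category.assoc, Category.assoc, h₂, Category.comp_id, reassoc_of% h₁]
  have ha : γ.hom₁ = a := by
    let r : T₁.obj₁ ⟶ (QK A).obj X₁ := e₁.hom.hom₁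
    let r' : (QK A).obj X₂ ⟶ T₂.obj₁ := e₂.inv.hom₁
    have h₁ : r ≫ p₁ = 𝟙 _ := e₁.hom_inv_id_triangle_hom₁
    have h₂ : p₂ ≫ r' = 𝟙 _ := e₂.hom_inv_id_triangle_hom₁
    change r ≫ (QK A).map a' ≫ r' = a
    rw [ha', Category.assoc, Category.assoc, h₂, Category.comp_id, reassoc_of% h₁]
  exact ⟨γ.hom₃, by rw [γ.comm₂, hb], by rw [← γ.comm₃, ha]⟩

instance : Pretriangulated (KOne A) where
  distinguishedTriangles := distTri A
  isomorphic_distinguished := distTri_of_iso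
  contractible_distinguished := contractible_distTri
  distinguished_cocone_triangle := exists_distTri
  rotate_distinguished_triangle := rotate_distTri
  complete_distinguished_triangle_morphism := complete_distTri

lemma coneTriK_distinguished {X Y : OnePeriodic A} (φ : X ⟶ Y) :
    coneTriK φ ∈ distTriang (KOne A) :=
  ⟨_, _, φ, ⟨Iso.refl _⟩⟩

end OnePeriodic

namespace HomologicalKernel

open CategoryTheory.Pretriangulated

variable {C : Type*} [Category* C] [Preadditive C] [HasZeroObject C] [HasShift C ℤ]
  [∀ n : ℤ, (shiftFunctor C n).Additive] [Pretriangulated C]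
  {B : Type*} [Category* B] [Abelian B] (F : C ⥤ B) [F.IsHomological]

lemma trW_iff {X Y : C} (f : X ⟶ Y) :
    F.homologicalKernel.trW f ↔ ∀ n : ℤ, IsIso (F.map (f⟦n⟧')) :=
  letI := Functor.ShiftSequence.tautological F ℤ
  F.mem_homologicalKernel_trW_iff f

instance : F.homologicalKernel.trW.IsMultiplicative where
  id_mem X := (trW_iff F _).2 fun n => by
    rw [CategoryTheory.Functor.map_id, CategoryTheory.Functor.map_id]; infer_instance
  comp_mem f g hf hg := (trW_iff F _).2 fun n => by
    have := (trW_iff F f).1 hf n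
    have := (trW_iff F g).1 hg n
    rw [Functor.map_comp, Functor.map_comp]; infer_instance

instance : F.homologicalKernel.trW.HasLeftCalculusOfFractions where
  exists_leftFraction X Y φ := by
    obtain ⟨Z, f, g, H, mem⟩ := φ.hs
    obtain ⟨Y', s', f', mem'⟩ := distinguished_cocone_triangle₂ (g ≫ φ.f⟦1⟧')
    obtain ⟨b, ⟨hb₁, _⟩⟩ :=
      complete_distinguished_triangle_morphism₂ _ _ H mem' φ.f (𝟙 Z) (Category.id_comp _).symm
    exact ⟨MorphismProperty.LeftFraction.mk b s' ⟨_, _, _, mem', mem⟩, hb₁.symm⟩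
  ext := by
    rintro X' X Y f₁ f₂ s ⟨Z, g, h, H, mem⟩ hf₁
    have hf₂ : s ≫ (f₁ - f₂) = 0 := by rw [Preadditive.comp_sub, hf₁, sub_self]
    obtain ⟨q, hq⟩ := Triangle.yoneda_exact₂ _ H _ hf₂
    obtain ⟨Y', r, t, mem'⟩ := distinguished_cocone_triangle q
    refine ⟨Y', r, ⟨_, _, _, rot_of_distTriang _ mem',
      F.homologicalKernel.le_shift _ _ mem⟩, ?_⟩
    have eq : q ≫ r = 0 := comp_distTriang_mor_zero₁₂ _ mem'
    rw [← sub_eq_zero, ← Preadditive.sub_comp, hq]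
    exact (Category.assoc _ _ _).trans ((congrArg (g ≫ ·) eq).trans comp_zero)

instance : F.homologicalKernel.trW.HasRightCalculusOfFractions where
  exists_rightFraction X Y φ := by
    obtain ⟨Z, f, g, H, mem⟩ := φ.hs
    obtain ⟨X', f', h', mem'⟩ := distinguished_cocone_triangle₁ (φ.f ≫ f)
    obtain ⟨a, ⟨ha₁, _⟩⟩ := complete_distinguished_triangle_morphism₁ _ _
      mem' H φ.f (𝟙 Z) (Category.comp_id _)
    exact ⟨MorphismProperty.RightFraction.mk f' ⟨_, _, _, mem', mem⟩ a, ha₁⟩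
  ext Y Z Z' f₁ f₂ s hs hf₁ := by
    rw [F.homologicalKernel.trW_iff'] at hs
    obtain ⟨Z, g, h, H, mem⟩ := hs
    have hf₂ : (f₁ - f₂) ≫ s = 0 := by rw [Preadditive.sub_comp, hf₁, sub_self]
    obtain ⟨q, hq⟩ := Triangle.coyoneda_exact₂ _ H _ hf₂
    obtain ⟨Y', r, t, mem'⟩ := distinguished_cocone_triangle₁ q
    refine ⟨Y', r, ⟨_, _, _, mem', mem⟩, ?_⟩
    have eq : r ≫ q = 0 := comp_distTriang_mor_zero₁₂ _ mem'
    rw [← sub_eq_zero, ← Preadditive.comp_sub, hq]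
    exact (Category.assoc _ _ _).symm.trans ((congrArg (· ≫ g) eq).trans zero_comp)

lemma isIso_map_hom₃ {T₁ T₂ : Triangle C} (h₁ : T₁ ∈ distTriang C) (h₂ : T₂ ∈ distTriang C)
    (φ : T₁ ⟶ T₂) (ha : F.homologicalKernel.trW φ.hom₁) (hb : F.homologicalKernel.trW φ.hom₂) :
    F.homologicalKernel.trW φ.hom₃ := by
  let := Functor.ShiftSequence.tautological F ℤ
  rw [F.mem_homologicalKernel_trW_iff] at ha hb ⊢
  intro n
  have e₁ := F.homologySequenceComposableArrows₅_exact T₁ h₁ n (n + 1) rfl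
  have e₂ := F.homologySequenceComposableArrows₅_exact T₂ h₂ n (n + 1) rfl
  have key (T T' : Triangle C) (φ : T ⟶ T') (n : ℤ) :
      (F.shift n).map T.mor₁ ≫ (F.shift n).map φ.hom₂ =
        (F.shift n).map φ.hom₁ ≫ (F.shift n).map T'.mor₁ := by
    rw [← Functor.map_comp, ← Functor.map_comp, φ.comm₁]
  have key' (T T' : Triangle C) (φ : T ⟶ T') (n : ℤ) :
      (F.shift n).map T.mor₂ ≫ (F.shift n).map φ.hom₃ =
        (F.shift n).map φ.hom₂ ≫ (F.shift n).map T'.mor₂ := by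
    rw [← Functor.map_comp, ← Functor.map_comp, φ.comm₂]
  have := ha n
  have := ha (n + 1)
  have := hb n
  have := hb (n + 1)
  let ψ : ComposableArrows.δlast (F.homologySequenceComposableArrows₅ T₁ n (n + 1) rfl) ⟶
      ComposableArrows.δlast (F.homologySequenceComposableArrows₅ T₂ n (n + 1) rfl) :=
    ComposableArrows.homMk₄ ((F.shift n).map φ.hom₁) ((F.shift n).map φ.hom₂)
      ((F.shift n).map φ.hom₃) ((F.shift (n+1)).map φ.hom₁) ((F.shift (n+1)).map φ.hom₂)
      (key _ _ φ n) (key' _ _ φ n) (F.homologySequenceδ_naturality _ _ φ n (n+1) rfl).symm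
      (key _ _ φ (n + 1))
  have := Abelian.isIso_of_epi_of_isIso_of_isIso_of_mono (R₁ := ComposableArrows.δlast _)
    (R₂ := ComposableArrows.δlast _) e₁.δlast e₂.δlast ψ
    (inferInstanceAs (Epi ((F.shift n).map φ.hom₁))) (inferInstanceAs (IsIso ((F.shift n).map φ.hom₂)))
    (inferInstanceAs (IsIso ((F.shift (n+1)).map φ.hom₁))) (inferInstanceAs (Mono ((F.shift (n+1)).map φ.hom₂)))
  exact this

instance : F.homologicalKernel.trW.IsCompatibleWithTriangulation where
  compatible_with_triangulation T₁ T₂ h₁ h₂ a b ha hb comm := by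
    obtain ⟨c, hc₂, hc₃⟩ := complete_distinguished_triangle_morphism T₁ T₂ h₁ h₂ a b comm
    exact ⟨c, isIso_map_hom₃ F h₁ h₂ ⟨a, b, c, comm, hc₂, hc₃⟩ ha hb, hc₂, hc₃⟩

end HomologicalKernel

namespace OnePeriodic

open CategoryTheory.Pretriangulated

variable {A : Type u} [Category.{v} A] [Abelian A]

variable (A) in
/-- The homology functor on the homotopy category of `1`-periodic complexes. -/
abbrev homK : KOne A ⥤ A := HomotopyCategory.homologyFunctor A oneShape ()

lemma coneInl_coneSnd {X Y : OnePeriodic A} (φ : X ⟶ Y) : coneInl φ ≫ coneSnd φ = 0 :=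
  hom_ext biprod.inl_snd

/-- The short exact sequence of a mapping cone. -/
abbrev coneShortComplex {X Y : OnePeriodic A} (φ : X ⟶ Y) : ShortComplex (OnePeriodic A) :=
  ShortComplex.mk (coneInl φ) (coneSnd φ) (coneInl_coneSnd φ)

lemma coneShortComplex_shortExact {X Y : OnePeriodic A} (φ : X ⟶ Y) :
    (coneShortComplex φ).ShortExact :=
  HomologicalComplex.shortExact_of_degreewise_shortExact _ fun _ =>
    ShortComplex.Splitting.shortExact
      (S := ShortComplex.mk (biprod.inl : Y.X () ⟶ Y.X () ⊞ X.X ()) biprod.snd biprod.inl_snd)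
      (ShortComplex.Splitting.ofHasBinaryBiproduct _ _)

instance : (homK A).IsHomological where
  __ := Functor.IsHomological.mk' (homK A) fun T hT => by
    obtain ⟨X, Y, φ, ⟨e⟩⟩ := inv_rot_of_distTriang _ hT
    let ι := HomotopyCategory.homologyFunctorFactors A oneShape ()
    let σ := (homK A).mapIso ((QK A).commShiftIso (1 : ℤ) |>.app X)
    refine ⟨(coneTriK φ).rotate, (triangleRotation _).counitIso.symm.app T ≪≫
      (rotate _).mapIso e, (ShortComplex.exact_iff_of_iso (S₂ :=
        (coneShortComplex φ).map (HomologicalComplex.homologyFunctor A oneShape ())) ?_).2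
      ((coneShortComplex_shortExact φ).homology_exact₂ ())⟩
    refine ShortComplex.isoMk (ι.app Y) (ι.app (cone1 φ)) (σ.symm ≪≫ ι.app _)
      (ι.hom.naturality (coneInl φ)).symm ?_
    change ι.hom.app _ ≫ (HomologicalComplex.homologyFunctor A oneShape ()).map (coneSnd φ) =
      (homK A).map ((QK A).map (coneSnd φ) ≫ ((QK A).commShiftIso (1 : ℤ)).hom.app X) ≫
        (homK A).map (((QK A).commShiftIso (1 : ℤ)).inv.app X) ≫ ι.hom.app _
    rw [← Category.assoc ((homK A).map _), ← Functor.map_comp, Category.assoc,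
      Iso.hom_inv_id_app]
    exact (ι.hom.naturality (coneSnd φ)).symm.trans (congrArg (fun t => (homK A).map t ≫
      ι.hom.app _) (Category.comp_id ((QK A).map (coneSnd φ))).symm)

instance : oneShape.QFactorsThroughHomotopy A :=
  oneShape.QFactorsThroughHomotopy_of_exists_prev (fun j => ⟨j, trivial⟩) A

lemma mem_quasiIso_iff {X Y : OnePeriodic A} (f : X ⟶ Y) :
    HomologicalComplex.quasiIso A oneShape f ↔
      ShortComplex.QuasiIso ((HomologicalComplex.shortComplexFunctor A oneShape ()).map f) :=
  ⟨fun h => (h.quasiIsoAt ()).quasiIso, fun h => ⟨fun _ => ⟨h⟩⟩⟩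

/-- Shifting a `1`-periodic complex does not change its short complexes, up to signs. -/
def scShiftIso (X : OnePeriodic A) (n : ℤ) :
    (HomologicalComplex.shortComplexFunctor A oneShape ()).obj X ≅
      (HomologicalComplex.shortComplexFunctor A oneShape ()).obj (X⟦n⟧) :=
  ShortComplex.isoMk (unitIso (X.X ()) n.negOnePow) (Iso.refl (X.X ()))
    (unitIso (X.X ()) n.negOnePow)
    (by
      change (n.negOnePow • 𝟙 (X.X ())) ≫ (n.negOnePow • X.d () ()) = X.d () () ≫ 𝟙 (X.X ())
      rw [Linear.units_smul_comp, Linear.comp_units_smul, smul_smul, Int.units_mul_self, one_smul,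
        Category.comp_id, Category.id_comp])
    (by
      change 𝟙 (X.X ()) ≫ (n.negOnePow • X.d () ()) = X.d () () ≫ (n.negOnePow • 𝟙 (X.X ()))
      rw [Linear.comp_units_smul, Category.id_comp, Linear.comp_units_smul, Category.comp_id])

lemma quasiIso_shift {X Y : OnePeriodic A} {f : X ⟶ Y}
    (hf : HomologicalComplex.quasiIso A oneShape f) (n : ℤ) :
    HomologicalComplex.quasiIso A oneShape (f⟦n⟧') := by
  rw [mem_quasiIso_iff] at hf ⊢
  have key : (n.negOnePow • 𝟙 (X.X ())) ≫ f.f () = f.f () ≫ (n.negOnePow • 𝟙 (Y.X ())) := by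
    rw [Linear.units_smul_comp, Linear.comp_units_smul, Category.comp_id, Category.id_comp]
  refine ShortComplex.quasiIso_of_arrow_mk_iso
    ((HomologicalComplex.shortComplexFunctor A oneShape ()).map f) _
    (Arrow.isoMk (scShiftIso X n) (scShiftIso Y n) ?_)
  exact ShortComplex.hom_ext _ _ key
    ((Category.id_comp (f.f ())).trans (Category.comp_id (f.f ())).symm) key

variable (A) in
lemma quasiIso_eq_trW :
    HomotopyCategory.quasiIso A oneShape = (homK A).homologicalKernel.trW := by
  ext X Y f
  rw [HomologicalKernel.trW_iff]
  constructor
  · intro hf n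
    obtain ⟨X, rfl⟩ := HomotopyCategory.quotient_obj_surjective X
    obtain ⟨Y, rfl⟩ := HomotopyCategory.quotient_obj_surjective Y
    obtain ⟨f, rfl⟩ := (QK A).map_surjective f
    rw [HomotopyCategory.quotient_map_mem_quasiIso_iff] at hf
    have := ((HomotopyCategory.quotient_map_mem_quasiIso_iff _).2 (quasiIso_shift hf n)) ()
    exact (((MorphismProperty.isomorphisms A).arrow_mk_iso_iff
      ((homK A).mapArrow.mapIso (((Functor.mapArrowFunctor _ _).mapIso ((QK A).commShiftIso n)).app
        (Arrow.mk f)))).1 this)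
  · intro h n
    have := h 0
    exact ((MorphismProperty.isomorphisms A).arrow_mk_iso_iff
      ((homK A).mapArrow.mapIso (((Functor.mapArrowFunctor _ _).mapIso
        (shiftFunctorZero (KOne A) ℤ)).app (Arrow.mk f)))).1 this

instance : (HomotopyCategory.quasiIso A oneShape).HasLeftCalculusOfFractions := by
  rw [quasiIso_eq_trW]; infer_instance

instance : (HomotopyCategory.quasiIso A oneShape).HasRightCalculusOfFractions := by
  rw [quasiIso_eq_trW]; infer_instance

instance : (HomotopyCategory.quasiIso A oneShape).IsCompatibleWithTriangulation := by
  rw [quasiIso_eq_trW]; infer_instance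

end OnePeriodic

namespace OnePeriodic

open CategoryTheory.Pretriangulated

variable {A : Type u} [Category.{v} A] [Abelian A]

instance : (HomotopyCategory.quotient A oneShape).IsLocalization
    (HomologicalComplex.homotopyEquivalences A oneShape) :=
  oneShape.quotient_isLocalization (fun j => ⟨j, trivial⟩) A

variable [MorphismProperty.HasLocalization.{w'} (HomologicalComplex.quasiIso A oneShape)]

variable (A) in
/-- The localization functor from the homotopy category of `1`-periodic complexes to the
`1`-periodic derived category. -/
abbrev QhD : KOne A ⥤ DOne A := HomologicalComplexUpToQuasiIso.Qh

instance : Preadditive (DOne A) :=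
  Localization.preadditive (QhD A) (HomotopyCategory.quasiIso A oneShape)

instance : (QhD A).Additive :=
  Localization.functor_additive (QhD A) (HomotopyCategory.quasiIso A oneShape)

instance : (QhD A).EssSurj :=
  Localization.essSurj _ (HomotopyCategory.quasiIso A oneShape)

instance : HasZeroObject (DOne A) := (QhD A).hasZeroObject_of_additive

instance : HasShift (DOne A) ℤ :=
  HasShift.localized (QhD A) (HomotopyCategory.quasiIso A oneShape) ℤ

instance : (QhD A).CommShift ℤ :=
  Functor.CommShift.localized (QhD A) (HomotopyCategory.quasiIso A oneShape) ℤ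

instance (n : ℤ) : (shiftFunctor (DOne A) n).Additive := by
  rw [Localization.functor_additive_iff (QhD A) (HomotopyCategory.quasiIso A oneShape)]
  exact Functor.additive_of_iso ((QhD A).commShiftIso n)

instance : Pretriangulated (DOne A) :=
  Triangulated.Localization.pretriangulated (QhD A) (HomotopyCategory.quasiIso A oneShape)

instance : (QhD A).IsTriangulated :=
  Triangulated.Localization.isTriangulated_functor (QhD A) (HomotopyCategory.quasiIso A oneShape)

lemma isIso_QD_map {X Y : OnePeriodic A} {f : X ⟶ Y}
    (hf : HomologicalComplex.quasiIso A oneShape f) : IsIso (QD.map f) :=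
  Localization.inverts QD (HomologicalComplex.quasiIso A oneShape) _ hf

/-- A morphism of the `1`-periodic derived category is a right fraction of morphisms of
complexes. -/
lemma exists_roof {X Y : OnePeriodic A} (f : QD.obj X ⟶ QD.obj Y) :
    ∃ (Z : OnePeriodic A) (s : Z ⟶ X) (g : Z ⟶ Y),
      HomologicalComplex.quasiIso A oneShape s ∧ QD.map s ≫ f = QD.map g := by
  obtain ⟨φ, hφ⟩ := Localization.exists_rightFraction (QhD A) (HomotopyCategory.quasiIso A oneShape)
    (X := (QK A).obj X) (Y := (QK A).obj Y) f
  obtain ⟨s, hs⟩ := (QK A).map_surjective (X := φ.X'.as) φ.s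
  obtain ⟨g, hg⟩ := (QK A).map_surjective (X := φ.X'.as) φ.f
  refine ⟨φ.X'.as, s, g, (HomotopyCategory.quotient_map_mem_quasiIso_iff s).1
    (hs.symm ▸ φ.hs), ?_⟩
  have := φ.map_s_comp_map (QhD A) (Localization.inverts _ _)
  rw [← hφ, ← hs, ← hg] at this
  exact this

/-- The triangle of `DOne A` given by a mapping cone. -/
lemma exists_cone_distinguished {X Y : OnePeriodic A} (g : X ⟶ Y) :
    ∃ (i : QD.obj Y ⟶ QD.obj (cone1 g)) (p : QD.obj (cone1 g) ⟶ (QD.obj X)⟦(1 : ℤ)⟧),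
      Triangle.mk (QD.map g) i p ∈ distTriang (DOne A) :=
  ⟨_, _, (QhD A).map_distinguished _ (coneTriK_distinguished g)⟩

lemma isConeOf_iff {X Y : A} (f : QD.obj (stalkC X) ⟶ QD.obj (stalkC Y)) (M : A) :
    IsConeOf f M ↔ ∃ (g : QD.obj (stalkC Y) ⟶ QD.obj (stalkC M))
      (h : QD.obj (stalkC M) ⟶ (QD.obj (stalkC X))⟦(1 : ℤ)⟧),
      Triangle.mk f g h ∈ distTriang (DOne A) := by
  constructor
  · rintro ⟨Z, s, g, hs, hf, ⟨e⟩⟩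
    have := isIso_QD_map hs
    obtain ⟨i, p, hT⟩ := exists_cone_distinguished g
    refine ⟨i ≫ e.hom, e.inv ≫ p ≫ (QD.map s)⟦1⟧', isomorphic_distinguished _ hT _
      (Triangle.isoMk _ _ (asIso (QD.map s)).symm (Iso.refl _) e.symm ?_ ?_ ?_)⟩
    · change f ≫ 𝟙 _ = inv (QD.map s) ≫ QD.map g
      rw [Category.comp_id, ← hf, IsIso.inv_hom_id_assoc]
    · change (i ≫ e.hom) ≫ e.inv = 𝟙 _ ≫ i
      rw [Category.assoc, e.hom_inv_id, Category.comp_id, Category.id_comp]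
    · change (e.inv ≫ p ≫ (QD.map s)⟦1⟧') ≫ (inv (QD.map s))⟦1⟧' = e.inv ≫ p
      rw [Category.assoc, Category.assoc, ← Functor.map_comp, IsIso.hom_inv_id,
        CategoryTheory.Functor.map_id, Category.comp_id]
  · rintro ⟨g, h, hT⟩
    obtain ⟨Z, s, a, hs, ha⟩ := exists_roof f
    have := isIso_QD_map hs
    obtain ⟨i, p, hT'⟩ := exists_cone_distinguished a
    let σ : QD.obj Z ≅ QD.obj (stalkC X) := asIso (QD.map s)
    let e := isoTriangleOfIso₁₂ _ _ hT' hT σ (Iso.refl _)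
      ((Category.comp_id (QD.map a)).trans ha.symm)
    exact ⟨Z, s, a, hs, ha, ⟨Triangle.π₃.mapIso e⟩⟩

/-- Stalk complexes are isomorphic to their shifts. -/
def stalkShiftIso (X : A) : (stalkC X)⟦(1 : ℤ)⟧ ≅ stalkC X :=
  mkIsoOfX (Iso.refl X) (by
    have key : 𝟙 X ≫ (0 : X ⟶ X) = ((1 : ℤ).negOnePow • (0 : X ⟶ X)) ≫ 𝟙 X := by
      rw [smul_zero, comp_zero, zero_comp]
    exact key)

/-- Stalk complexes are isomorphic to their shifts in the derived category. -/
def stalkShiftIsoD (X : A) :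
    (QD.obj (stalkC X) : DOne A)⟦(1 : ℤ)⟧ ≅ QD.obj (stalkC X) :=
  ((QhD A).commShiftIso (1 : ℤ)).symm.app ((QK A).obj (stalkC X)) ≪≫
    (QhD A).mapIso (((QK A).commShiftIso (1 : ℤ)).symm.app (stalkC X)) ≪≫
      QD.mapIso (stalkShiftIso X)

end OnePeriodic

namespace TriangleCount

open CategoryTheory.Pretriangulated

lemma card_ker_mul_card_range {G H : Type*} [AddGroup G] [AddGroup H] (φ : G →+ H) :
    Nat.card φ.ker * Nat.card φ.range = Nat.card G := by
  rw [← AddSubgroup.index_ker, AddSubgroup.card_mul_index]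

/-- If all nonempty fibres over a subset have the same cardinality as the kernel,
the preimage of the subset is counted by the kernel. -/
lemma card_preimage_of_addMonoidHom {G H : Type*} [AddCommGroup G] [AddCommGroup H] (φ : G →+ H)
    (p : H → Prop) (hp : ∀ y, p y → y ∈ φ.range) :
    Nat.card {x // p (φ x)} = Nat.card {y // p y} * Nat.card φ.ker := by
  choose σ hσ using hp
  rw [← Nat.card_prod]
  refine Nat.card_congr
    { toFun x := ⟨⟨φ x, x.2⟩, ⟨x.1 - σ _ x.2, by
        rw [AddMonoidHom.mem_ker, map_sub, hσ, sub_self]⟩⟩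
      invFun y := ⟨σ _ y.1.2 + y.2, by
        rw [map_add, hσ, AddMonoidHom.mem_ker.1 y.2.2, add_zero]; exact y.1.2⟩
      left_inv x := Subtype.ext (add_sub_cancel _ _)
      right_inv y := ?_ }
  obtain ⟨⟨y, hy⟩, ⟨k, hk⟩⟩ := y
  have h : φ (σ y hy + k) = y := by rw [map_add, hσ, AddMonoidHom.mem_ker.1 hk, add_zero]
  refine Prod.ext (Subtype.ext h) (Subtype.ext ?_)
  have h' : ∀ (z : H) (hz : p z), z = y → σ z hz = σ y hy := by rintro z hz rfl; rfl
  change σ y hy + k - σ _ _ = k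
  rw [h' _ _ h, add_sub_cancel_left]

lemma isIso_add_comp_comm {C : Type*} [Category* C] [Preadditive C] {X Y : C} (h : X ⟶ Y)
    (c : Y ⟶ X) (hc : IsIso (𝟙 X + h ≫ c)) : IsIso (𝟙 Y + c ≫ h) := by
  obtain ⟨u, h₁, h₂⟩ := hc
  rw [Preadditive.add_comp, Category.id_comp, Category.assoc] at h₁
  rw [Preadditive.comp_add, Category.comp_id] at h₂
  refine ⟨𝟙 Y - c ≫ u ≫ h, ?_, ?_⟩
  · rw [Preadditive.add_comp, Category.id_comp, Preadditive.comp_sub, Category.comp_id]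
    have : (c ≫ h) ≫ c ≫ u ≫ h = c ≫ (h ≫ c ≫ u) ≫ h := by simp only [Category.assoc]
    have h₃ : h ≫ c ≫ u = 𝟙 X - u := eq_sub_of_add_eq' h₁
    rw [this, h₃, Preadditive.sub_comp, Preadditive.comp_sub, Category.id_comp]
    abel
  · rw [Preadditive.sub_comp, Category.id_comp, Preadditive.comp_add, Category.comp_id]
    have : (c ≫ u ≫ h) ≫ c ≫ h = c ≫ (u ≫ h ≫ c) ≫ h := by simp only [Category.assoc]
    have h₃ : u ≫ h ≫ c = 𝟙 X - u := eq_sub_of_add_eq' h₂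
    rw [this, h₃, Preadditive.sub_comp, Preadditive.comp_sub, Category.id_comp]
    abel

/-- Isomorphisms of `X` satisfying a condition correspond to the invertible endomorphisms
satisfying it. -/
def autEquiv {C : Type*} [Category* C] {X : C} (p : (X ⟶ X) → Prop) :
    {a : Aut X // p a.hom} ≃ {a : X ⟶ X // IsIso a ∧ p a} where
  toFun a := ⟨a.1.hom, Iso.isIso_hom a.1, a.2⟩
  invFun a := ⟨@asIso _ _ _ _ a.1 a.2.1, a.2.2⟩
  left_inv _ := Subtype.ext (Iso.ext rfl)
  right_inv _ := rfl

variable {C : Type*} [Category* C] [Preadditive C] [HasZeroObject C] [HasShift C ℤ]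
  [∀ n : ℤ, (shiftFunctor C n).Additive] [Pretriangulated C]

section

variable {Y M X : C} {f : Y ⟶ M} {g : M ⟶ X} {h : X ⟶ Y⟦(1 : ℤ)⟧}
  (hT : Triangle.mk f g h ∈ distTriang C)
include hT

lemma comp_eq_zero_iff₃ {Z : C} (a : X ⟶ Z) : g ≫ a = 0 ↔ ∃ c, h ≫ c = a := by
  refine ⟨fun ha => ?_, ?_⟩
  · obtain ⟨c, hc⟩ := Triangle.yoneda_exact₃ _ hT a ha
    exact ⟨c, hc.symm⟩
  · rintro ⟨c, rfl⟩
    have : g ≫ h = 0 := comp_distTriang_mor_zero₂₃ _ hT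
    rw [← Category.assoc, this, zero_comp]

lemma comp_eq_zero_iff₂ {Z : C} (a : M ⟶ Z) : f ≫ a = 0 ↔ ∃ c, g ≫ c = a := by
  refine ⟨fun ha => ?_, ?_⟩
  · obtain ⟨c, hc⟩ := Triangle.yoneda_exact₂ _ hT a ha
    exact ⟨c, hc.symm⟩
  · rintro ⟨c, rfl⟩
    have : f ≫ g = 0 := comp_distTriang_mor_zero₁₂ _ hT
    rw [← Category.assoc, this, zero_comp]

lemma comp_eq_zero_iff_shift {Z : C} (a : Y⟦(1 : ℤ)⟧ ⟶ Z) :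
    h ≫ a = 0 ↔ ∃ c, f⟦(1 : ℤ)⟧' ≫ c = a := by
  refine ⟨fun ha => ?_, ?_⟩
  · obtain ⟨c, hc⟩ := Triangle.yoneda_exact₃ _ (rot_of_distTriang _ hT) a ha
    exact ⟨-c, (Preadditive.comp_neg _ _).trans ((Preadditive.neg_comp _ _).symm.trans hc.symm)⟩
  · rintro ⟨c, rfl⟩
    have : h ≫ f⟦(1 : ℤ)⟧' = 0 := comp_distTriang_mor_zero₃₁ _ hT
    rw [← Category.assoc, this, zero_comp]

lemma comp_eq_zero_iff_coyoneda₂ {Z : C} (a : Z ⟶ M) : a ≫ g = 0 ↔ ∃ c, c ≫ f = a := by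
  refine ⟨fun ha => ?_, ?_⟩
  · obtain ⟨c, hc⟩ := Triangle.coyoneda_exact₂ _ hT a ha
    exact ⟨c, hc.symm⟩
  · rintro ⟨c, rfl⟩
    have : f ≫ g = 0 := comp_distTriang_mor_zero₁₂ _ hT
    rw [Category.assoc, this, comp_zero]

lemma comp_eq_zero_iff_coyoneda₃ {Z : C} (a : Z ⟶ X) : a ≫ h = 0 ↔ ∃ c, c ≫ g = a := by
  refine ⟨fun ha => ?_, ?_⟩
  · obtain ⟨c, hc⟩ := Triangle.coyoneda_exact₃ _ hT a ha
    exact ⟨c, hc.symm⟩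
  · rintro ⟨c, rfl⟩
    have : g ≫ h = 0 := comp_distTriang_mor_zero₂₃ _ hT
    rw [Category.assoc, this, comp_zero]

lemma comp_eq_zero_iff_coyoneda₁ {Z : C} (a : Z ⟶ Y⟦(1 : ℤ)⟧) :
    a ≫ f⟦(1 : ℤ)⟧' = 0 ↔ ∃ c, c ≫ h = a := by
  refine ⟨fun ha => ?_, ?_⟩
  · obtain ⟨c, hc⟩ := Triangle.coyoneda_exact₁ _ hT a ha
    exact ⟨c, hc.symm⟩
  · rintro ⟨c, rfl⟩
    have : h ≫ f⟦(1 : ℤ)⟧' = 0 := comp_distTriang_mor_zero₃₁ _ hT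
    rw [Category.assoc, this, comp_zero]

lemma card_isIso_eq_card_stabilizer₃ :
    Nat.card {c : Y⟦(1 : ℤ)⟧ ⟶ X // IsIso (𝟙 X + h ≫ c)} =
      Nat.card {a : Aut X // g ≫ a.hom = g} * Nat.card (Preadditive.leftComp X h).ker := by
  have e := card_preimage_of_addMonoidHom (Preadditive.leftComp X h)
    (fun a => IsIso (𝟙 X + a) ∧ g ≫ a = 0) (fun a ha => (comp_eq_zero_iff₃ hT a).1 ha.2)
  have e₁ : Nat.card {c : Y⟦(1 : ℤ)⟧ ⟶ X // IsIso (𝟙 X + h ≫ c)} =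
      Nat.card {c : Y⟦(1 : ℤ)⟧ ⟶ X // IsIso (𝟙 X + h ≫ c) ∧ g ≫ h ≫ c = 0} :=
    Nat.card_congr (Equiv.subtypeEquivRight fun c =>
      (and_iff_left ((comp_eq_zero_iff₃ hT _).2 ⟨c, rfl⟩)).symm)
  have e₂ : Nat.card {a : X ⟶ X // IsIso (𝟙 X + a) ∧ g ≫ a = 0} =
      Nat.card {a : Aut X // g ≫ a.hom = g} := by
    refine Nat.card_congr (((Equiv.addLeft (𝟙 X)).subtypeEquiv fun a => ?_).trans
      (autEquiv fun a => g ≫ a = g).symm)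
    refine and_congr Iff.rfl ?_
    rw [Equiv.coe_addLeft, Preadditive.comp_add, Category.comp_id, add_eq_left]
  rw [← e₂]
  exact e₁.trans e

lemma card_isIso_eq_card_stabilizer₁ :
    Nat.card {c : Y⟦(1 : ℤ)⟧ ⟶ X // IsIso (𝟙 (Y⟦(1 : ℤ)⟧) + c ≫ h)} =
      Nat.card {a : Aut Y // a.hom ≫ f = f} *
        Nat.card (Preadditive.rightComp (Y⟦(1 : ℤ)⟧) h).ker := by
  have e := card_preimage_of_addMonoidHom (Preadditive.rightComp (Y⟦(1 : ℤ)⟧) h)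
    (fun a => IsIso (𝟙 _ + a) ∧ a ≫ f⟦(1 : ℤ)⟧' = 0)
    (fun a ha => (comp_eq_zero_iff_coyoneda₁ hT a).1 ha.2)
  have e₁ : Nat.card {c : Y⟦(1 : ℤ)⟧ ⟶ X // IsIso (𝟙 (Y⟦(1 : ℤ)⟧) + c ≫ h)} =
      Nat.card {c : Y⟦(1 : ℤ)⟧ ⟶ X // IsIso (𝟙 (Y⟦(1 : ℤ)⟧) + c ≫ h) ∧
        (c ≫ h) ≫ f⟦(1 : ℤ)⟧' = 0} :=
    Nat.card_congr (Equiv.subtypeEquivRight fun c =>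
      (and_iff_left ((comp_eq_zero_iff_coyoneda₁ hT _).2 ⟨c, rfl⟩)).symm)
  have e₂ : Nat.card {a : Y⟦(1 : ℤ)⟧ ⟶ Y⟦(1 : ℤ)⟧ // IsIso (𝟙 _ + a) ∧ a ≫ f⟦(1 : ℤ)⟧' = 0} =
      Nat.card {a : Aut Y // a.hom ≫ f = f} := by
    let e₃ : {a : Y ⟶ Y // IsIso a ∧ a ≫ f = f} ≃ {a : Y⟦(1 : ℤ)⟧ ⟶ Y⟦(1 : ℤ)⟧ //
        IsIso a ∧ a ≫ f⟦(1 : ℤ)⟧' = f⟦(1 : ℤ)⟧'} :=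
      (Functor.FullyFaithful.ofFullyFaithful (shiftFunctor C (1 : ℤ))).homEquiv.subtypeEquiv
        fun a => by
          change _ ↔ IsIso (a⟦(1 : ℤ)⟧') ∧ a⟦(1 : ℤ)⟧' ≫ f⟦(1 : ℤ)⟧' = f⟦(1 : ℤ)⟧'
          rw [isIso_iff_of_reflects_iso, ← Functor.map_comp, Functor.map_injective_iff]
    refine Nat.card_congr ((((Equiv.addLeft (𝟙 _)).subtypeEquiv fun a => ?_).trans e₃.symm).trans
      (autEquiv fun a => a ≫ f = f).symm)
    refine and_congr Iff.rfl ?_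
    rw [Equiv.coe_addLeft, Preadditive.add_comp, Category.id_comp, add_eq_left]
  rw [← e₂]
  exact e₁.trans e

/-- Morphisms into a shift-invariant object are invariant under shifting the source. -/
def shiftSourceEquiv {Z : C} (e : Z⟦(1 : ℤ)⟧ ≅ Z) (W : C) : (W ⟶ Z) ≃ (W⟦(1 : ℤ)⟧ ⟶ Z) :=
  (Functor.FullyFaithful.ofFullyFaithful (shiftFunctor C (1 : ℤ))).homEquiv.trans e.homToEquiv

omit hT [Preadditive C] [HasZeroObject C] [∀ n : ℤ, (shiftFunctor C n).Additive] [Pretriangulated C] in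
lemma shiftSourceEquiv_apply {Z : C} (e : Z⟦(1 : ℤ)⟧ ≅ Z) (W : C) (c : W ⟶ Z) :
    shiftSourceEquiv e W c = c⟦(1 : ℤ)⟧' ≫ e.hom := rfl

lemma card_ker_leftComp (eX : X⟦(1 : ℤ)⟧ ≅ X) (eY : Y⟦(1 : ℤ)⟧ ≅ Y) :
    Nat.card (Preadditive.leftComp X h).ker ^ 2 * Nat.card (X ⟶ X) =
      Nat.card (M ⟶ X) * Nat.card (Y ⟶ X) := by
  have h₁ := card_ker_mul_card_range (Preadditive.leftComp X h)
  have h₂ := card_ker_mul_card_range (Preadditive.leftComp X g)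
  have h₃ := card_ker_mul_card_range (Preadditive.leftComp X f)
  have e₁ : (Preadditive.leftComp X g).ker = (Preadditive.leftComp X h).range :=
    AddSubgroup.ext fun a => comp_eq_zero_iff₃ hT a
  have e₂ : (Preadditive.leftComp X f).ker = (Preadditive.leftComp X g).range :=
    AddSubgroup.ext fun a => comp_eq_zero_iff₂ hT a
  have e₃ : Nat.card (Preadditive.leftComp X f).range =
      Nat.card (Preadditive.leftComp X h).ker := by
    refine Nat.card_congr ((shiftSourceEquiv eX Y).subtypeEquiv fun a => ?_)
    change (∃ c, f ≫ c = a) ↔ h ≫ shiftSourceEquiv eX Y a = 0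
    rw [comp_eq_zero_iff_shift hT, ← (shiftSourceEquiv eX M).exists_congr_right]
    refine exists_congr fun c => ?_
    rw [← (shiftSourceEquiv eX Y).apply_eq_iff_eq, shiftSourceEquiv_apply, shiftSourceEquiv_apply,
      shiftSourceEquiv_apply, Functor.map_comp, Category.assoc]
  have e₄ : Nat.card (Y⟦(1 : ℤ)⟧ ⟶ X) = Nat.card (Y ⟶ X) := Nat.card_congr eY.homFromEquiv
  rw [e₁] at h₂
  rw [e₂, e₃] at h₃
  rw [e₄] at h₁
  rw [← h₁, ← h₂, ← h₃]
  ring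

lemma card_ker_rightComp (eY : Y⟦(1 : ℤ)⟧ ≅ Y) :
    Nat.card (Preadditive.rightComp (Y⟦(1 : ℤ)⟧) h).ker ^ 2 * Nat.card (Y ⟶ Y) =
      Nat.card (Y ⟶ M) * Nat.card (Y ⟶ X) := by
  have h₁ := card_ker_mul_card_range (Preadditive.rightComp (Y⟦(1 : ℤ)⟧) h)
  have h₂ := card_ker_mul_card_range (Preadditive.rightComp Y f)
  have h₃ := card_ker_mul_card_range (Preadditive.rightComp (Y⟦(1 : ℤ)⟧) g)
  have h₄ := card_ker_mul_card_range (Preadditive.rightComp Y g)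
  have e₁ : (Preadditive.rightComp (Y⟦(1 : ℤ)⟧) h).ker =
      (Preadditive.rightComp (Y⟦(1 : ℤ)⟧) g).range :=
    AddSubgroup.ext fun a => comp_eq_zero_iff_coyoneda₃ hT a
  have e₂ : (Preadditive.rightComp Y g).ker = (Preadditive.rightComp Y f).range :=
    AddSubgroup.ext fun a => comp_eq_zero_iff_coyoneda₂ hT a
  have e₃ : Nat.card (Preadditive.rightComp Y f).ker =
      Nat.card (Preadditive.rightComp (Y⟦(1 : ℤ)⟧) h).range := by
    refine Nat.card_congr ((Functor.FullyFaithful.ofFullyFaithful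
      (shiftFunctor C (1 : ℤ))).homEquiv.subtypeEquiv fun a => ?_)
    change a ≫ f = 0 ↔ ∃ c, c ≫ h = a⟦(1 : ℤ)⟧'
    rw [← comp_eq_zero_iff_coyoneda₁ hT, ← Functor.map_comp, Functor.map_eq_zero_iff]
  have e₄ : Nat.card (Y⟦(1 : ℤ)⟧ ⟶ X) = Nat.card (Y ⟶ X) := Nat.card_congr eY.homFromEquiv
  have e₅ : Nat.card (Preadditive.rightComp (Y⟦(1 : ℤ)⟧) g).range =
      Nat.card (Preadditive.rightComp Y g).range := by
    refine Nat.card_congr (eY.homFromEquiv.subtypeEquiv fun a => ?_)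
    change (∃ c, c ≫ g = a) ↔ (∃ c, c ≫ g = eY.inv ≫ a)
    rw [← eY.homFromEquiv.exists_congr_right]
    refine exists_congr fun c => ?_
    change _ ↔ (eY.inv ≫ c) ≫ g = _
    rw [Category.assoc, cancel_epi]
  rw [e₂, ← e₅, ← e₁] at h₄
  rw [e₃] at h₂
  rw [e₄] at h₁
  rw [← h₁, ← h₂, ← h₄]
  ring

end

end TriangleCount

namespace TriangleCount

open CategoryTheory.Pretriangulated

variable {C : Type*} [Category* C] [Preadditive C] [HasZeroObject C] [HasShift C ℤ]
  [∀ n : ℤ, (shiftFunctor C n).Additive] [Pretriangulated C]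

lemma exists_aut₃ {Y M X : C} {f : Y ⟶ M} {g g' : M ⟶ X} {h h' : X ⟶ Y⟦(1 : ℤ)⟧}
    (hT : Triangle.mk f g h ∈ distTriang C) (hT' : Triangle.mk f g' h' ∈ distTriang C) :
    ∃ a : Aut X, g ≫ a.hom = g' := by
  obtain ⟨c, h₁, h₂⟩ := complete_distinguished_triangle_morphism _ _ hT hT' (𝟙 Y) (𝟙 M)
    ((Category.comp_id f).trans (Category.id_comp f).symm)
  let φ : Triangle.mk f g h ⟶ Triangle.mk f g' h' :=
    { hom₁ := 𝟙 Y
      hom₂ := 𝟙 M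
      hom₃ := c
      comm₁ := (Category.comp_id f).trans (Category.id_comp f).symm
      comm₂ := h₁
      comm₃ := h₂ }
  have : IsIso c := isIso₃_of_isIso₁₂ φ hT hT' (inferInstanceAs (IsIso (𝟙 Y)))
    (inferInstanceAs (IsIso (𝟙 M)))
  exact ⟨@asIso _ _ _ _ c this, h₁.trans (Category.id_comp g')⟩

lemma exists_aut₁ {Y M X : C} {f f' : Y ⟶ M} {g : M ⟶ X} {h h' : X ⟶ Y⟦(1 : ℤ)⟧}
    (hT : Triangle.mk f g h ∈ distTriang C) (hT' : Triangle.mk f' g h' ∈ distTriang C) :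
    ∃ a : Aut Y, a.hom ≫ f' = f := by
  obtain ⟨c, h₁, h₂⟩ := complete_distinguished_triangle_morphism₁ _ _ hT hT' (𝟙 M) (𝟙 X)
    ((Category.comp_id g).trans (Category.id_comp g).symm)
  let φ : Triangle.mk f g h ⟶ Triangle.mk f' g h' :=
    { hom₁ := c
      hom₂ := 𝟙 M
      hom₃ := 𝟙 X
      comm₁ := h₁
      comm₂ := (Category.comp_id g).trans (Category.id_comp g).symm
      comm₃ := h₂ }
  have : IsIso c := isIso₁_of_isIso₂₃ φ hT hT' (inferInstanceAs (IsIso (𝟙 M)))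
    (inferInstanceAs (IsIso (𝟙 X)))
  exact ⟨@asIso _ _ _ _ c this, h₁.symm.trans (Category.comp_id f)⟩

/-- Counting pairs related by `r` through a transitive group action on the fibres over the first
coordinate. -/
lemma card_mul_card_eq_card_sigma {S T G : Type*} [Group G] (act : G → T → T)
    (hact : ∀ a b t, act (a * b) t = act a (act b t)) (hone : ∀ t, act 1 t = t)
    (r : S → T → Prop) (hr : ∀ s t t', r s t → r s t' → ∃ a, act a t = t')
    (hr' : ∀ s t a, r s t → r s (act a t)) :
    Nat.card {s // ∃ t, r s t} * Nat.card G =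
      Nat.card (Σ p : {p : S × T // r p.1 p.2}, {a : G // act a p.1.2 = p.1.2}) := by
  cases isEmpty_or_nonempty T
  · simp
  choose! σ hσ using fun (s : S) (hs : ∃ t, r s t) => hs
  choose! α hα using fun s t (h : r s t) => hr s (σ s) t (hσ s ⟨t, h⟩) h
  rw [← Nat.card_prod]
  refine Nat.card_congr
    { toFun x := ⟨⟨(x.1.1, act x.2 (σ x.1.1)), hr' _ _ _ (hσ _ x.1.2)⟩,
        ⟨x.2 * (α x.1.1 (act x.2 (σ x.1.1)))⁻¹, ?_⟩⟩
      invFun y := (⟨y.1.1.1, _, y.1.2⟩, y.2.1 * α y.1.1.1 y.1.1.2)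
      left_inv x := ?_
      right_inv y := ?_ }
  · have h := hα _ _ (hr' _ _ x.2 (hσ _ x.1.2))
    change act _ (act _ _) = act _ _
    rw [hact]
    congr 1
    refine (congrArg _ h.symm).trans ?_
    rw [← hact, inv_mul_cancel, hone]
  · exact Prod.ext rfl (inv_mul_cancel_right _ _)
  · obtain ⟨⟨⟨s, t⟩, h⟩, ⟨a, ha⟩⟩ := y
    have e : act (a * α s t) (σ s) = t := by rw [hact, hα _ _ h]; exact ha
    refine Sigma.subtype_ext (Subtype.ext (Prod.ext rfl e)) ?_
    change a * α s t * (α s (act (a * α s t) (σ s)))⁻¹ = a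
    rw [e, mul_inv_cancel_right]

variable {Y M X : C}

variable (Y M X) in
lemma card_mul_card_aut₃ :
    Nat.card {f : Y ⟶ M // ∃ (g : M ⟶ X) (h : X ⟶ Y⟦(1 : ℤ)⟧), Triangle.mk f g h ∈ distTriang C} *
      Nat.card (Aut X) =
    Nat.card (Σ p : {p : (Y ⟶ M) × (M ⟶ X) // ∃ h : X ⟶ Y⟦(1 : ℤ)⟧,
      Triangle.mk p.1 p.2 h ∈ distTriang C}, {a : Aut X // p.1.2 ≫ a.hom = p.1.2}) := by
  refine card_mul_card_eq_card_sigma (fun (a : Aut X) (g : M ⟶ X) => g ≫ a.hom)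
    (fun a b g => (Category.assoc _ _ _).symm) (fun g => Category.comp_id g)
    (fun f g => ∃ h : X ⟶ Y⟦(1 : ℤ)⟧, Triangle.mk f g h ∈ distTriang C) ?_ ?_
  · rintro f g g' ⟨h, hT⟩ ⟨h', hT'⟩
    exact exists_aut₃ hT hT'
  · rintro f g a ⟨h, hT⟩
    refine ⟨a.inv ≫ h, isomorphic_distinguished _ hT _ ?_⟩
    exact Triangle.isoMk _ _ (Iso.refl _) (Iso.refl _) a.symm
      ((Category.comp_id f).trans (Category.id_comp f).symm)
      ((Category.assoc _ _ _).trans ((congrArg (g ≫ ·) a.hom_inv_id).trans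
        ((Category.comp_id g).trans (Category.id_comp g).symm)))
      ((congrArg ((a.inv ≫ h) ≫ ·) (CategoryTheory.Functor.map_id _ _)).trans (Category.comp_id _))

variable (Y M X) in
lemma card_mul_card_aut₁ :
    Nat.card {g : M ⟶ X // ∃ (f : Y ⟶ M) (h : X ⟶ Y⟦(1 : ℤ)⟧), Triangle.mk f g h ∈ distTriang C} *
      Nat.card (Aut Y) =
    Nat.card (Σ p : {p : (Y ⟶ M) × (M ⟶ X) // ∃ h : X ⟶ Y⟦(1 : ℤ)⟧,
      Triangle.mk p.1 p.2 h ∈ distTriang C}, {a : Aut Y // a.hom ≫ p.1.1 = p.1.1}) := by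
  refine (card_mul_card_eq_card_sigma (fun (a : Aut Y) (f : Y ⟶ M) => a.inv ≫ f)
    (fun a b g => Category.assoc _ _ _) (fun g => Category.id_comp g)
    (fun g f => ∃ h : X ⟶ Y⟦(1 : ℤ)⟧, Triangle.mk f g h ∈ distTriang C) ?_ ?_).trans
    (Nat.card_congr (Equiv.sigmaCongr ((Equiv.prodComm _ _).subtypeEquiv fun _ => Iff.rfl)
      fun p => Equiv.subtypeEquivRight fun a => ?_))
  · rintro g f f' ⟨h, hT⟩ ⟨h', hT'⟩
    obtain ⟨a, ha⟩ := exists_aut₁ hT hT'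
    exact ⟨a, a.inv_comp_eq.2 ha.symm⟩
  · rintro g f a ⟨h, hT⟩
    refine ⟨h ≫ a.hom⟦(1 : ℤ)⟧', isomorphic_distinguished _ hT _ ?_⟩
    refine Triangle.isoMk _ _ a.symm (Iso.refl _) (Iso.refl _)
      (Category.comp_id _)
      ((Category.comp_id g).trans (Category.id_comp g).symm) ?_
    refine (Category.assoc _ _ _).trans (Eq.trans ?_ (Category.id_comp h).symm)
    refine (congrArg (h ≫ ·) ((Functor.map_comp _ _ _).symm.trans ?_)).trans (Category.comp_id h)
    exact (congrArg (shiftFunctor C (1 : ℤ)).map a.hom_inv_id).trans (CategoryTheory.Functor.map_id _ _)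
  · exact a.inv_comp_eq.trans eq_comm

lemma card_stabilizer_mul_sqrt [Finite (X ⟶ X)] [Finite (Y ⟶ Y)] [Finite (Y ⟶ X)]
    {f : Y ⟶ M} {g : M ⟶ X} {h : X ⟶ Y⟦(1 : ℤ)⟧}
    (hT : Triangle.mk f g h ∈ distTriang C) (eX : X⟦(1 : ℤ)⟧ ≅ X) (eY : Y⟦(1 : ℤ)⟧ ≅ Y) :
    (Nat.card {a : Aut X // g ≫ a.hom = g} : ℝ) *
        √(Nat.card (Y ⟶ Y) * Nat.card (M ⟶ X)) =
      Nat.card {a : Aut Y // a.hom ≫ f = f} * √(Nat.card (X ⟶ X) * Nat.card (Y ⟶ M)) := by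
  have h₁ := card_isIso_eq_card_stabilizer₃ hT
  have h₂ := card_isIso_eq_card_stabilizer₁ hT
  have h₃ := card_ker_leftComp hT eX eY
  have h₄ := card_ker_rightComp hT eY
  have e : Nat.card {c : Y⟦(1 : ℤ)⟧ ⟶ X // IsIso (𝟙 X + h ≫ c)} =
      Nat.card {c : Y⟦(1 : ℤ)⟧ ⟶ X // IsIso (𝟙 (Y⟦(1 : ℤ)⟧) + c ≫ h)} :=
    Nat.card_congr (Equiv.subtypeEquivRight fun c =>
      ⟨isIso_add_comp_comm h c, isIso_add_comp_comm c h⟩)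
  rw [h₁, h₂] at e
  generalize Nat.card (Preadditive.leftComp X h).ker = κ at *
  generalize Nat.card (Preadditive.rightComp (Y⟦(1 : ℤ)⟧) h).ker = μ at *
  have p₃ : 0 < Nat.card (Y ⟶ X) := Nat.card_pos
  generalize Nat.card (X ⟶ X) = xx at *
  generalize Nat.card (Y ⟶ Y) = yy at *
  generalize Nat.card (Y ⟶ X) = yx at *
  generalize Nat.card (M ⟶ X) = mx at *
  generalize Nat.card (Y ⟶ M) = ym at *
  generalize Nat.card {a : Aut X // g ≫ a.hom = g} = s at *
  generalize Nat.card {a : Aut Y // a.hom ≫ f = f} = t at *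
  have key : (s : ℝ) ^ 2 * (yy * mx) = t ^ 2 * (xx * ym) := by
    have : (s ^ 2 * (yy * mx)) * yx = (t ^ 2 * (xx * ym)) * yx := by
      calc _ = s ^ 2 * yy * (mx * yx) := by ring
        _ = (s * κ) ^ 2 * (yy * xx) := by rw [← h₃]; ring
        _ = (t * μ) ^ 2 * (yy * xx) := by rw [e]
        _ = t ^ 2 * xx * (ym * yx) := by rw [← h₄]; ring
        _ = _ := by ring
    exact_mod_cast Nat.eq_of_mul_eq_mul_right p₃ this
  have := congrArg Real.sqrt key
  rwa [Real.sqrt_mul (sq_nonneg _), Real.sqrt_mul (sq_nonneg _), Real.sqrt_sq (Nat.cast_nonneg _),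
    Real.sqrt_sq (Nat.cast_nonneg _)] at this

lemma exists_rotate_iff (eY : Y⟦(1 : ℤ)⟧ ≅ Y) (g : M ⟶ X) :
    (∃ (f : Y ⟶ M) (h : X ⟶ Y⟦(1 : ℤ)⟧), Triangle.mk f g h ∈ distTriang C) ↔
      ∃ (h : X ⟶ Y) (f : Y ⟶ M⟦(1 : ℤ)⟧), Triangle.mk g h f ∈ distTriang C := by
  constructor
  · rintro ⟨f, h, hT⟩
    refine ⟨h ≫ eY.hom, eY.inv ≫ (-f⟦(1 : ℤ)⟧'),
      isomorphic_distinguished _ (rot_of_distTriang _ hT) _ ?_⟩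
    refine Triangle.isoMk _ _ (Iso.refl _) (Iso.refl _) eY.symm
      ((Category.comp_id g).trans (Category.id_comp g).symm) ?_ ?_
    · exact (Category.assoc _ _ _).trans ((congrArg (h ≫ ·) eY.hom_inv_id).trans
        ((Category.comp_id h).trans (Category.id_comp h).symm))
    · exact (congrArg ((eY.inv ≫ (-f⟦(1 : ℤ)⟧')) ≫ ·) (CategoryTheory.Functor.map_id _ _)).trans
        (Category.comp_id _)
  · rintro ⟨h, f, hT⟩
    obtain ⟨f', hf'⟩ := (shiftFunctor C (1 : ℤ)).map_surjective (-(eY.hom ≫ f))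
    refine ⟨f', h ≫ eY.inv, ?_⟩
    rw [rotate_distinguished_triangle]
    refine isomorphic_distinguished _ hT _ ?_
    refine Triangle.isoMk _ _ (Iso.refl _) (Iso.refl _) eY
      ((Category.comp_id g).trans (Category.id_comp g).symm) ?_ ?_
    · exact (Category.assoc _ _ _).trans ((congrArg (h ≫ ·) eY.inv_hom_id).trans
        ((Category.comp_id h).trans (Category.id_comp h).symm))
    · refine (congrArg ((-f'⟦(1 : ℤ)⟧') ≫ ·) (CategoryTheory.Functor.map_id _ _)).trans
        ((Category.comp_id _).trans ?_)
      rw [hf', neg_neg]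
      rfl

variable (Y M X) in
/-- The number of morphisms `Y ⟶ M` with cone `X` compared with the number of morphisms `M ⟶ X`
with cone `Y`, in a triangulated category of period one. -/
theorem card_mul_sqrt_eq [Finite (X ⟶ X)] [Finite (Y ⟶ Y)] [Finite (Y ⟶ X)] [Finite (Y ⟶ M)]
    [Finite (M ⟶ X)]
    (eX : X⟦(1 : ℤ)⟧ ≅ X) (eY : Y⟦(1 : ℤ)⟧ ≅ Y) :
    (Nat.card {f : Y ⟶ M // ∃ (g : M ⟶ X) (h : X ⟶ Y⟦(1 : ℤ)⟧),
        Triangle.mk f g h ∈ distTriang C} * Nat.card (Aut X) : ℝ) *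
        √(Nat.card (Y ⟶ Y) * Nat.card (M ⟶ X)) =
      (Nat.card {g : M ⟶ X // ∃ (h : X ⟶ Y) (f : Y ⟶ M⟦(1 : ℤ)⟧),
        Triangle.mk g h f ∈ distTriang C} * Nat.card (Aut Y)) *
        √(Nat.card (X ⟶ X) * Nat.card (Y ⟶ M)) := by
  have : Finite (Aut X) := Finite.of_injective Iso.hom fun _ _ h => Iso.ext h
  have : Finite (Aut Y) := Finite.of_injective Iso.hom fun _ _ h => Iso.ext h
  have := Fintype.ofFinite {p : (Y ⟶ M) × (M ⟶ X) // ∃ h : X ⟶ Y⟦(1 : ℤ)⟧,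
      Triangle.mk p.1 p.2 h ∈ distTriang C}
  simp_rw [← exists_rotate_iff eY]
  have h₃ := congrArg (Nat.cast (R := ℝ)) (card_mul_card_aut₃ Y M X)
  have h₁ := congrArg (Nat.cast (R := ℝ)) (card_mul_card_aut₁ Y M X)
  rw [Nat.card_sigma, Nat.cast_mul, Nat.cast_sum] at h₁ h₃
  refine (congrArg (· * _) h₃).trans (Eq.trans ?_ (congrArg (· * _) h₁).symm)
  refine (Finset.sum_mul _ _ _).trans (Eq.trans ?_ (Finset.sum_mul _ _ _).symm)
  refine Finset.sum_congr rfl fun p _ => ?_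
  obtain ⟨h, hT⟩ := p.2
  exact card_stabilizer_mul_sqrt hT eX eY

end TriangleCount

namespace ExtRealization

open Abelian DerivedCategory

variable {A : Type u} [Category.{v} A] [Abelian A]

lemma epi_iCycles_comp_f {K : CochainComplex A ℤ} {X : A} (s : K ⟶ (CochainComplex.singleFunctor A 0).obj X)
    [QuasiIso s] : Epi (K.iCycles 0 ≫ s.f 0) := by
  let S := (CochainComplex.singleFunctor A 0).obj X
  have hd : ∀ i j, S.d i j = 0 := fun i j => HomologicalComplex.single_obj_d _ _ _ _ _
  have : IsIso (S.iCycles 0) := ShortComplex.isIso_iCycles _ (hd _ _)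
  have : IsIso (S.homologyπ 0) := ShortComplex.isIso_homologyπ _ (hd _ _)
  have h : Epi (HomologicalComplex.cyclesMap s 0 ≫ S.homologyπ 0) := by
    have : IsIso (HomologicalComplex.homologyMap s 0) := inferInstance
    exact (HomologicalComplex.homologyπ_naturality s 0) ▸ epi_comp (K.homologyπ 0) _
  have h' : Epi (HomologicalComplex.cyclesMap s 0) :=
    (epi_comp_iff_of_isIso _ (S.homologyπ 0)).1 h
  exact (HomologicalComplex.cyclesMap_i s 0) ▸ epi_comp (HomologicalComplex.cyclesMap s 0) _

lemma epi_of_iso_hom_comp_eq {C : Type*} [Category* C] {U U' V V' : C} (e : U ≅ U') (e' : V ≅ V')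
    (p : U' ⟶ V') (t : U' ⟶ V) (ht : Epi t) (h : e.hom ≫ p ≫ e'.inv = e.hom ≫ t) : Epi p := by
  rw [cancel_epi, Iso.comp_inv_eq] at h
  rw [h]
  infer_instance

lemma comp_eq_zero_of_fac {C : Type*} [Category* C] [HasZeroMorphisms C] {U V W W' K : C}
    (c : W ⟶ W') [Mono c] (p : U ⟶ V) (z : V ⟶ W) (s : K ⟶ V) [IsIso s] (j : U ⟶ K) {g : K ⟶ W'}
    (hz : z ≫ c = inv s ≫ g) (hp : p = j ≫ s) (h : j ≫ g = 0) : p ≫ z = 0 := by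
  rw [← cancel_mono c, Category.assoc, hz, hp, Category.assoc, IsIso.hom_inv_id_assoc, h, zero_comp]

variable [HasExt.{w} A]

lemma exists_epi_comp_eq_zero {X Z : A} (ζ : Ext.{w} X Z 1) :
    ∃ (P : A) (p : P ⟶ X), Epi p ∧ (Ext.mk₀ p).comp ζ (zero_add 1) = 0 := by
  let := HasDerivedCategory.standard A
  obtain ⟨K, s, hs, g, hg⟩ := right_fac (C := A) (X := (CochainComplex.singleFunctor A 0).obj X)
    (Y := ((CochainComplex.singleFunctor A 0).obj Z)⟦(1 : ℤ)⟧)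
    (ζ.hom ≫ (Q.commShiftIso (1 : ℤ)).inv.app ((CochainComplex.singleFunctor A 0).obj Z))
  have : QuasiIso s := (isIso_Q_map_iff_quasiIso _ s).1 hs
  let j : (CochainComplex.singleFunctor A 0).obj (K.cycles 0) ⟶ K :=
    HomologicalComplex.mkHomFromSingle (K.iCycles 0) fun k _ => K.iCycles_d 0 k
  have hj : j ≫ g = 0 := HomologicalComplex.from_single_hom_ext
    ((HomologicalComplex.isZero_single_obj_X (ComplexShape.up ℤ) 0 Z (0 + 1) (by simp)).eq_of_tgt
      _ _)
  obtain ⟨p, hp⟩ := (CochainComplex.singleFunctor A 0).map_surjective (j ≫ s)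
  refine ⟨K.cycles 0, p, ?_, ?_⟩
  · have h := congrArg (fun φ => HomologicalComplex.Hom.f φ 0) hp
    have h' : ((CochainComplex.singleFunctor A 0).map p).f 0 =
        (HomologicalComplex.singleObjXSelf (ComplexShape.up ℤ) 0 (K.cycles 0)).hom ≫
          K.iCycles 0 ≫ s.f 0 :=
      h.trans ((congrArg (· ≫ s.f 0) (HomologicalComplex.mkHomFromSingle_f _ _)).trans
        (Category.assoc _ _ _))
    exact epi_of_iso_hom_comp_eq _ _ p _ (epi_iCycles_comp_f s)
      ((HomologicalComplex.single_map_f_self (c := ComplexShape.up ℤ) (0 : ℤ) p).symm.trans h')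
  · refine Ext.ext ?_
    rw [Ext.comp_hom, Ext.mk₀_hom, Ext.zero_hom]
    refine (ShiftedHom.mk₀_comp _ _ _ _).trans ?_
    refine comp_eq_zero_of_fac
      ((Q.commShiftIso (1 : ℤ)).inv.app ((CochainComplex.singleFunctor A 0).obj Z))
      (Q.map ((CochainComplex.singleFunctor A 0).map p)) ζ.hom (Q.map s) (Q.map j) hg
      ((congrArg Q.map hp).trans (Q.map_comp j s))
      ((Q.map_comp j g).symm.trans ((congrArg Q.map hj).trans (Q.map_zero _ _)))

lemma exists_extClass_comp {X Z : A} (ζ : Ext.{w} X Z 1) :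
    ∃ (N P : A) (i : N ⟶ P) (p : P ⟶ X) (w : i ≫ p = 0) (hS : (ShortComplex.mk i p w).ShortExact)
      (a : N ⟶ Z), hS.extClass.comp (Ext.mk₀ a) (add_zero 1) = ζ := by
  obtain ⟨P, p, hp, h⟩ := exists_epi_comp_eq_zero ζ
  have hS : (ShortComplex.mk (kernel.ι p) p (kernel.condition p)).ShortExact :=
    { exact := ShortComplex.exact_of_f_is_kernel _ (kernelIsKernel p)
      mono_f := inferInstanceAs (Mono (kernel.ι p))
      epi_g := hp }
  obtain ⟨x, hx⟩ := Ext.contravariant_sequence_exact₃ hS Z ζ h (add_zero 1)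
  obtain ⟨a, rfl⟩ := (Ext.mk₀_bijective _ _).2 x
  exact ⟨_, _, _, _, _, hS, a, hx⟩

end ExtRealization

namespace OnePeriodic

lemma quasiIso_iff_of_zeros {A : Type*} [Category* A] [Abelian A]
    {S T : ShortComplex A} (φ : S ⟶ T) (hf : T.f = 0) (hg : T.g = 0) {K : A} (ι : K ⟶ S.X₂)
    (wι : ι ≫ S.g = 0) (hι : IsLimit (KernelFork.ofι ι wι)) (e : S.X₁ ⟶ K) (he : e ≫ ι = S.f)
    (w : e ≫ ι ≫ φ.τ₂ = 0) :
    ShortComplex.QuasiIso φ ↔ (ShortComplex.mk e (ι ≫ φ.τ₂) w).Exact ∧ Epi (ι ≫ φ.τ₂) := by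
  have he' : hι.lift (KernelFork.ofι _ S.zero) = e :=
    Fork.IsLimit.hom_ext hι ((Fork.IsLimit.lift_ι hι).trans he.symm)
  subst he'
  let h₁ : S.LeftHomologyData :=
    { K := K
      H := cokernel (hι.lift (KernelFork.ofι _ S.zero))
      i := ι
      π := cokernel.π _
      wi := wι
      hi := hι
      wπ := cokernel.condition _
      hπ := cokernelIsCokernel _ }
  let h₂ := ShortComplex.LeftHomologyData.ofZeros T hf hg
  let γ : ShortComplex.LeftHomologyMapData φ h₁ h₂ :=
    { φK := ι ≫ φ.τ₂
      φH := cokernel.desc _ (ι ≫ φ.τ₂) w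
      commi := Category.comp_id _
      commf' := by
        rw [ShortComplex.LeftHomologyData.ofZeros_f', comp_zero]
        exact w
      commπ := (cokernel.π_desc _ _ _).trans (Category.comp_id _).symm }
  rw [γ.quasiIso_iff, show Epi (ι ≫ φ.τ₂) ↔ Epi (ShortComplex.mk _ (ι ≫ φ.τ₂) w).g from Iff.rfl,
    ShortComplex.exact_and_epi_g_iff_g_is_cokernel]
  constructor
  · intro h
    exact ⟨IsColimit.ofIsoColimit (cokernelIsCokernel _)
      (Cofork.ext (@asIso _ _ _ _ _ h) (cokernel.π_desc _ _ _))⟩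
  · rintro ⟨h⟩
    exact (inferInstance : IsIso ((cokernelIsCokernel _).coconePointUniqueUpToIso h).hom)

variable {A : Type u} [Category.{v} A] [Abelian A]

lemma quasiIso_stalkC_iff {Z : OnePeriodic A} {X : A} (s : Z ⟶ stalkC X) {K : A}
    (ι : K ⟶ Z.X ()) (wι : ι ≫ Z.d () () = 0) (hι : IsLimit (KernelFork.ofι ι wι))
    (e : Z.X () ⟶ K) (he : e ≫ ι = Z.d () ()) (w : e ≫ ι ≫ s.f () = 0) :
    HomologicalComplex.quasiIso A oneShape s ↔
      (ShortComplex.mk e (ι ≫ s.f ()) w).Exact ∧ Epi (ι ≫ s.f ()) := by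
  rw [mem_quasiIso_iff]
  exact quasiIso_iff_of_zeros
    ((HomologicalComplex.shortComplexFunctor A oneShape ()).map s) rfl rfl ι wι hι e he w

/-- The complex `N ⊕ P` with differential given by `i : N ⟶ P`. -/
def extC {N P : A} (i : N ⟶ P) : OnePeriodic A where
  X _ := N ⊞ P
  d _ _ := biprod.fst ≫ i ≫ biprod.inr
  shape _ _ h := absurd trivial h
  d_comp_d' := by intros; simp

/-- The morphism from `extC i` with given components. -/
def extDesc {N P : A} {i : N ⟶ P} {Z : OnePeriodic A} (a : N ⟶ Z.X ()) (b : P ⟶ Z.X ())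
    (h₁ : a ≫ Z.d () () = i ≫ b) (h₂ : b ≫ Z.d () () = 0) : extC i ⟶ Z where
  f _ := biprod.desc a b
  comm' _ _ _ := by
    have key : biprod.desc a b ≫ Z.d () () = (biprod.fst ≫ i ≫ biprod.inr) ≫ biprod.desc a b := by
      ext <;> simp [h₁, h₂]
    exact key

/-- The morphism from `extC i` to a stalk complex with given components. -/
abbrev extDescStalk {N P X : A} {i : N ⟶ P} (a : N ⟶ X) (b : P ⟶ X) (h : i ≫ b = 0) :
    extC i ⟶ stalkC X :=
  extDesc (Z := stalkC X) a b (comp_zero.trans h.symm) comp_zero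

lemma extDesc_comp_stalk {N P X : A} {i : N ⟶ P} {Z : OnePeriodic A} (a : N ⟶ Z.X ())
    (b : P ⟶ Z.X ()) (h₁ : a ≫ Z.d () () = i ≫ b) (h₂ : b ≫ Z.d () () = 0) (g : Z ⟶ stalkC X)
    (a' : N ⟶ X) (b' : P ⟶ X) (h : i ≫ b' = 0) (ha : a ≫ g.f () = a') (hb : b ≫ g.f () = b') :
    extDesc a b h₁ h₂ ≫ g = extDescStalk a' b' h := by
  subst ha hb
  have key {U : A} (t : Z.X () ⟶ U) :
      biprod.desc a b ≫ t = biprod.desc (a ≫ t) (b ≫ t) := by ext <;> simp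
  exact hom_ext (key _)

/-- A morphism between the complexes `extC`. -/
def extMap {N P N' P' : A} {i : N ⟶ P} {i' : N' ⟶ P'} (n : N ⟶ N') (p : P ⟶ P')
    (h : n ≫ i' = i ≫ p) : extC i ⟶ extC i' :=
  extDesc (Z := extC i') (n ≫ biprod.inl) (p ≫ biprod.inr)
    (show (n ≫ biprod.inl) ≫ biprod.fst ≫ i' ≫ biprod.inr = i ≫ p ≫ biprod.inr by
      simp [reassoc_of% h])
    (show (p ≫ biprod.inr) ≫ biprod.fst ≫ i' ≫ biprod.inr = 0 by simp)

lemma extMap_comp_stalk {N P N' P' X : A} {i : N ⟶ P} {i' : N' ⟶ P'} (n : N ⟶ N') (p : P ⟶ P')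
    (h : n ≫ i' = i ≫ p) (a : N' ⟶ X) (b : P' ⟶ X) (h' : i' ≫ b = 0)
    (h'' : i ≫ p ≫ b = 0) :
    extMap n p h ≫ extDescStalk a b h' = extDescStalk (n ≫ a) (p ≫ b) h'' := by
  have key : biprod.desc (n ≫ biprod.inl) (p ≫ biprod.inr) ≫ biprod.desc a b =
    biprod.desc (n ≫ a) (p ≫ b) := by ext <;> simp
  exact hom_ext key

lemma quasiIso_extDescStalk {N P X : A} {i : N ⟶ P} {p : P ⟶ X} {w : i ≫ p = 0}
    (hS : (ShortComplex.mk i p w).ShortExact) (u : N ⟶ X) :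
    HomologicalComplex.quasiIso A oneShape (extDescStalk u p w) := by
  have hi : Mono i := hS.mono_f
  have hp : Epi p := hS.epi_g
  have w₀ : (biprod.inr : P ⟶ N ⊞ P) ≫ biprod.fst ≫ i ≫ (biprod.inr : P ⟶ N ⊞ P) = 0 := by simp
  have hι : IsLimit (KernelFork.ofι (f := biprod.fst ≫ i ≫ (biprod.inr : P ⟶ N ⊞ P))
      (biprod.inr : P ⟶ N ⊞ P) w₀) :=
    KernelFork.IsLimit.ofι' _ _ fun {W} k hk => ⟨k ≫ biprod.snd, by
      have : k ≫ biprod.fst = 0 := by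
        rw [← cancel_mono (i ≫ (biprod.inr : P ⟶ N ⊞ P)), zero_comp, Category.assoc]
        exact hk
      ext <;> simp [this]⟩
  have e₀ : biprod.inr ≫ biprod.desc u p = p := biprod.inr_desc _ _
  have w₁ : (biprod.fst ≫ i : N ⊞ P ⟶ P) ≫ biprod.inr ≫ biprod.desc u p = 0 := by simp [w]
  refine (quasiIso_stalkC_iff (extDescStalk u p w) (Z := extC i) biprod.inr w₀ hι
    (biprod.fst ≫ i) (Category.assoc _ _ _) w₁).2 ?_
  constructor
  · rw [ShortComplex.exact_iff_exact_up_to_refinements]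
    intro W x hx
    have hx' : x ≫ p = 0 := (congrArg (x ≫ ·) e₀).symm.trans hx
    refine ⟨W, 𝟙 W, inferInstance, hS.exact.lift x hx' ≫ biprod.inl, ?_⟩
    have : (hS.exact.lift x hx' ≫ biprod.inl) ≫ (biprod.fst ≫ i : N ⊞ P ⟶ P) =
        hS.exact.lift x hx' ≫ i := by simp
    exact (Category.id_comp x).trans ((hS.exact.lift_f x hx').symm.trans this.symm)
  · exact e₀.symm ▸ hp

variable [MorphismProperty.HasLocalization.{w'} (HomologicalComplex.quasiIso A oneShape)]

lemma QD_map_extDescStalk_eq {N P X : A} {i : N ⟶ P} (a a' : N ⟶ X) (b : P ⟶ X) (h : i ≫ b = 0)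
    (c : P ⟶ X) (hc : a = i ≫ c + a') :
    QD.map (extDescStalk a b h) = QD.map (extDescStalk a' b h) := by
  refine HomologicalComplexUpToQuasiIso.Q_map_eq_of_homotopy (mkHomotopy (biprod.snd ≫ c) ?_)
  have key : biprod.desc a b = (biprod.fst ≫ i ≫ (biprod.inr : P ⟶ N ⊞ P)) ≫ biprod.snd ≫ c +
      (biprod.snd ≫ c) ≫ 0 + biprod.desc a' b := by
    ext <;> simp [hc]
  exact key

end OnePeriodic

namespace OnePeriodic

open Abelian

variable {A : Type u} [Category.{v} A] [Abelian A]

/-- A refinement of short exact sequences with the same quotient. -/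
structure IsRefinement {N P X N' P' : A} (i : N ⟶ P) (p : P ⟶ X) (i' : N' ⟶ P') (p' : P' ⟶ X)
    (n : N' ⟶ N) (r : P' ⟶ P) : Prop where
  fac_left : n ≫ i = i' ≫ r
  fac_right : r ≫ p = p'

lemma exists_shortExact_of_epi {P X : A} (p : P ⟶ X) (hp : Epi p) :
    (ShortComplex.mk (kernel.ι p) p (kernel.condition p)).ShortExact where
  exact := ShortComplex.exact_of_f_is_kernel _ (kernelIsKernel p)
  mono_f := inferInstanceAs (Mono (kernel.ι p))
  epi_g := hp

lemma exists_isRefinement {N P X P' : A} {i : N ⟶ P} {p : P ⟶ X} {w : i ≫ p = 0}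
    (hS : (ShortComplex.mk i p w).ShortExact) (p' : P' ⟶ X) (r : P' ⟶ P) (hr : r ≫ p = p') :
    ∃ n : kernel p' ⟶ N, IsRefinement i p (kernel.ι p') p' n r := by
  have : Mono i := hS.mono_f
  have h : (kernel.ι p' ≫ r) ≫ p = 0 := by rw [Category.assoc, hr, kernel.condition]
  exact ⟨hS.exact.lift _ h, hS.exact.lift_f _ h, hr⟩

lemma exists_common_refinement {N P X N' P' : A} {i : N ⟶ P} {p : P ⟶ X} {w : i ≫ p = 0}
    (hS : (ShortComplex.mk i p w).ShortExact) {i' : N' ⟶ P'} {p' : P' ⟶ X} {w' : i' ≫ p' = 0}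
    (hS' : (ShortComplex.mk i' p' w').ShortExact) :
    ∃ (N'' P'' : A) (i'' : N'' ⟶ P'') (p'' : P'' ⟶ X) (w'' : i'' ≫ p'' = 0)
      (n : N'' ⟶ N) (r : P'' ⟶ P) (n' : N'' ⟶ N') (r' : P'' ⟶ P'),
      (ShortComplex.mk i'' p'' w'').ShortExact ∧ IsRefinement i p i'' p'' n r ∧
        IsRefinement i' p' i'' p'' n' r' := by
  have : Epi p := hS.epi_g
  have : Epi p' := hS'.epi_g
  have hp : Epi (pullback.fst p p' ≫ p) := epi_comp _ _
  obtain ⟨n, hn⟩ := exists_isRefinement hS (pullback.fst p p' ≫ p) (pullback.fst p p') rfl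
  obtain ⟨n', hn'⟩ := exists_isRefinement hS' (pullback.fst p p' ≫ p) (pullback.snd p p')
    pullback.condition.symm
  exact ⟨_, _, _, _, _, n, _, n', _, exists_shortExact_of_epi _ hp, hn, hn'⟩

section

variable [HasExt.{w} A]

lemma IsRefinement.extClass_comp {N P X N' P' Y : A} {i : N ⟶ P} {p : P ⟶ X} {i' : N' ⟶ P'}
    {p' : P' ⟶ X} {n : N' ⟶ N} {r : P' ⟶ P} (h : IsRefinement i p i' p' n r) {w : i ≫ p = 0}
    (hS : (ShortComplex.mk i p w).ShortExact) {w' : i' ≫ p' = 0}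
    (hS' : (ShortComplex.mk i' p' w').ShortExact) (a : N ⟶ Y) :
    hS'.extClass.comp (Ext.mk₀ (n ≫ a)) (add_zero 1) =
      hS.extClass.comp (Ext.mk₀ a) (add_zero 1) := by
  have := ShortComplex.ShortExact.extClass_naturality hS' hS
    { τ₁ := n
      τ₂ := r
      τ₃ := 𝟙 X
      comm₁₂ := h.fac_left
      comm₂₃ := h.fac_right.trans (Category.comp_id _).symm }
  have this' : hS'.extClass.comp (Ext.mk₀ n) (add_zero 1) = hS.extClass :=
    this.trans (Ext.mk₀_id_comp _)
  rw [← this', Ext.comp_assoc_of_second_deg_zero, Ext.mk₀_comp_mk₀]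

lemma exists_eq_comp_add {N P X Y : A} {i : N ⟶ P} {p : P ⟶ X} {w : i ≫ p = 0}
    (hS : (ShortComplex.mk i p w).ShortExact) (a a' : N ⟶ Y)
    (h : hS.extClass.comp (Ext.mk₀ a) (add_zero 1) =
      hS.extClass.comp (Ext.mk₀ a') (add_zero 1)) : ∃ c : P ⟶ Y, a = i ≫ c + a' := by
  have h' : hS.extClass.comp (Ext.mk₀ (a - a')) (add_zero 1) = 0 := by
    rw [sub_eq_add_neg, Ext.mk₀_add, Ext.mk₀_neg, Ext.comp_add, Ext.comp_neg, h, add_neg_cancel]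
  obtain ⟨x, hx⟩ := Ext.contravariant_sequence_exact₁ hS Y _ (add_zero 1) h'
  obtain ⟨c, rfl⟩ := (Ext.mk₀_bijective _ _).2 x
  refine ⟨c, ?_⟩
  have hx' : i ≫ c = a - a' := (Ext.mk₀_bijective _ _).1 ((Ext.mk₀_comp_mk₀ _ _).symm.trans hx)
  rw [hx', sub_add_cancel]

end

variable [MorphismProperty.HasLocalization.{w'} (HomologicalComplex.quasiIso A oneShape)]

/-- The morphism `φ` of the derived category is represented by the components `a`, `b` on the
resolution `extC i` of `X`. -/
def IsRepr {N P X Y : A} {i : N ⟶ P} {p : P ⟶ X} {w : i ≫ p = 0}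
    (_ : (ShortComplex.mk i p w).ShortExact) (a : N ⟶ Y) (c : X ⟶ Y)
    (φ : QD.obj (stalkC X) ⟶ QD.obj (stalkC Y)) : Prop :=
  ∃ (b : P ⟶ Y) (hb : i ≫ b = 0), p ≫ c = b ∧
    QD.map (extDescStalk 0 p w) ≫ φ = QD.map (extDescStalk a b hb)

lemma IsRepr.of_isRefinement {N P X Y N' P' : A} {i : N ⟶ P} {p : P ⟶ X} {w : i ≫ p = 0}
    {hS : (ShortComplex.mk i p w).ShortExact} {a : N ⟶ Y} {c : X ⟶ Y}
    {φ : QD.obj (stalkC X) ⟶ QD.obj (stalkC Y)} (hφ : IsRepr hS a c φ)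
    {i' : N' ⟶ P'} {p' : P' ⟶ X} {n : N' ⟶ N} {r : P' ⟶ P} (h : IsRefinement i p i' p' n r)
    {w' : i' ≫ p' = 0} (hS' : (ShortComplex.mk i' p' w').ShortExact) :
    IsRepr hS' (n ≫ a) c φ := by
  obtain ⟨b, hb, hc, e⟩ := hφ
  obtain ⟨h₁, rfl⟩ := h
  have hb' : i' ≫ r ≫ b = 0 := by rw [← Category.assoc, ← h₁, Category.assoc, hb, comp_zero]
  refine ⟨r ≫ b, hb', by rw [← hc, Category.assoc], ?_⟩
  have e₁ := extMap_comp_stalk n r h₁ 0 p w w'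
  have e₂ := extMap_comp_stalk n r h₁ a b hb hb'
  rw [← e₂, Functor.map_comp, ← e, ← Category.assoc, ← Functor.map_comp, e₁]
  congr 3
  exact comp_zero.symm

/-- The morphisms between stalk complexes which are represented on a resolution `extC i`. -/
def HasRepr {X Y : A} (φ : QD.obj (stalkC X) ⟶ QD.obj (stalkC Y)) : Prop :=
  ∃ (N P : A) (i : N ⟶ P) (p : P ⟶ X) (w : i ≫ p = 0)
    (hS : (ShortComplex.mk i p w).ShortExact) (a : N ⟶ Y) (c : X ⟶ Y), IsRepr hS a c φ

lemma hasRepr_of_comp {N P X Y : A} {i : N ⟶ P} {p : P ⟶ X} {w : i ≫ p = 0}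
    (hS : (ShortComplex.mk i p w).ShortExact) (a : N ⟶ Y) (b : P ⟶ Y) (hb : i ≫ b = 0)
    {φ : QD.obj (stalkC X) ⟶ QD.obj (stalkC Y)}
    (h : QD.map (extDescStalk 0 p w) ≫ φ = QD.map (extDescStalk a b hb)) : HasRepr φ := by
  have : Epi p := hS.epi_g
  exact ⟨N, P, i, p, w, hS, a, hS.exact.desc b hb, b, hb, hS.exact.g_desc b hb, h⟩

variable [HasExt.{w} A]

lemma IsRepr.eq {N P X Y N' P' : A} {i : N ⟶ P} {p : P ⟶ X} {w : i ≫ p = 0}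
    {hS : (ShortComplex.mk i p w).ShortExact} {a : N ⟶ Y} {c : X ⟶ Y}
    {φ : QD.obj (stalkC X) ⟶ QD.obj (stalkC Y)} (hφ : IsRepr hS a c φ)
    {i' : N' ⟶ P'} {p' : P' ⟶ X} {w' : i' ≫ p' = 0}
    {hS' : (ShortComplex.mk i' p' w').ShortExact} {a' : N' ⟶ Y}
    {φ' : QD.obj (stalkC X) ⟶ QD.obj (stalkC Y)} (hφ' : IsRepr hS' a' c φ')
    (h : hS.extClass.comp (Ext.mk₀ a) (add_zero 1) =
      hS'.extClass.comp (Ext.mk₀ a') (add_zero 1)) : φ = φ' := by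
  obtain ⟨N'', P'', i'', p'', w'', n, r, n', r', hS'', hr, hr'⟩ := exists_common_refinement hS hS'
  rw [← hr.extClass_comp hS hS'', ← hr'.extClass_comp hS' hS''] at h
  obtain ⟨d, hd⟩ := exists_eq_comp_add hS'' _ _ h
  obtain ⟨b, hb, rfl, e⟩ := hφ.of_isRefinement hr hS''
  obtain ⟨b', hb', rfl, e'⟩ := hφ'.of_isRefinement hr' hS''
  have := isIso_QD_map (quasiIso_extDescStalk hS'' 0)
  rw [← cancel_epi (QD.map (extDescStalk 0 p'' w'')), e, e']
  exact QD_map_extDescStalk_eq _ _ _ _ d hd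

lemma finite_hasRepr (X Y : A) [Finite (X ⟶ Y)] [Finite (Ext.{w} X Y 1)] :
    Finite {φ : QD.obj (stalkC X) ⟶ QD.obj (stalkC Y) // HasRepr φ} := by
  choose N P i p w hS a c h using
    fun φ : {φ : QD.obj (stalkC X) ⟶ QD.obj (stalkC Y) // HasRepr φ} => φ.2
  refine Finite.of_injective
    (fun φ => (((hS φ).extClass.comp (Ext.mk₀ (a φ)) (add_zero 1), c φ) : Ext X Y 1 × (X ⟶ Y))) fun φ φ' e => ?_
  obtain ⟨e₁, e₂⟩ := Prod.ext_iff.1 e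
  have h' := h φ
  rw [show c φ = c φ' from e₂] at h'
  exact Subtype.ext (h'.eq (h φ') e₁)

end OnePeriodic

namespace OnePeriodic

open Abelian

variable {A : Type u} [Category.{v} A] [Abelian A] [HasExt.{w} A]

/-- In a hereditary category, a quasi-isomorphism to a stalk complex can be refined to a
complex `extC i`. -/
lemma exists_extC_refinement (hHered : ∀ X Y : A, Subsingleton (Ext.{w} X Y 2)) {X : A}
    {Z : OnePeriodic A} (s : Z ⟶ stalkC X) (hs : HomologicalComplex.quasiIso A oneShape s) :
    ∃ (N P : A) (i : N ⟶ P) (p : P ⟶ X) (w : i ≫ p = 0) (_ : (ShortComplex.mk i p w).ShortExact)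
      (a : N ⟶ Z.X ()) (b : P ⟶ Z.X ()), a ≫ Z.d () () = i ≫ b ∧ b ≫ Z.d () () = 0 ∧
        b ≫ s.f () = p := by
  let D := Z.d () ()
  let t : Z.X () ⟶ X := s.f ()
  have hD : D ≫ D = 0 := Z.d_comp_d () () ()
  have ht : D ≫ t = 0 := (s.comm () ()).symm.trans comp_zero
  let e : Z.X () ⟶ kernel D := kernel.lift D D hD
  have he : e ≫ kernel.ι D = D := kernel.lift_ι _ _ _
  have w₁ : e ≫ kernel.ι D ≫ t = 0 := by rw [← Category.assoc, he, ht]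
  obtain ⟨hexact, hepi⟩ := (quasiIso_stalkC_iff s (kernel.ι D) (kernel.condition D)
    (kernelIsKernel D) e he w₁).1 hs
  have hS₁ := exists_shortExact_of_epi (kernel.ι D ≫ t) hepi
  let β := kernel.ι (kernel.ι D ≫ t)
  let π : Z.X () ⟶ kernel (kernel.ι D ≫ t) := kernel.lift _ e w₁
  have hπ : π ≫ β = e := kernel.lift_ι _ _ _
  have w₂ : kernel.ι D ≫ π = 0 := by
    rw [← cancel_mono β, ← cancel_mono (kernel.ι D), Category.assoc, Category.assoc,
      reassoc_of% hπ, he, kernel.condition, zero_comp, zero_comp]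
  have hS₂ : (ShortComplex.mk (kernel.ι D) π w₂).ShortExact :=
    { exact := ShortComplex.exact_of_f_is_kernel _ (KernelFork.IsLimit.ofι' _ _ fun k hk =>
        ⟨kernel.lift D k (by rw [← he, ← hπ, Category.assoc, reassoc_of% hk, zero_comp]),
          kernel.lift_ι _ _ _⟩)
      mono_f := inferInstanceAs (Mono (kernel.ι D))
      epi_g := hexact.epi_kernelLift }
  obtain ⟨ζ, hζ⟩ := Ext.covariant_sequence_exact₃ X hS₂ hS₁.extClass (rfl : 1 + 1 = 2)
    (@Subsingleton.elim _ (hHered _ _) _ _)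
  obtain ⟨N, P, i, p, w, hS, a, rfl⟩ := ExtRealization.exists_extClass_comp ζ
  obtain ⟨N', P', i', p', w', n, r, n', r', hS', hr, hr'⟩ := exists_common_refinement hS hS₁
  have h : hS'.extClass.comp (Ext.mk₀ (n ≫ a ≫ π)) (add_zero 1) =
      hS'.extClass.comp (Ext.mk₀ (n' ≫ 𝟙 _)) (add_zero 1) := by
    rw [hr.extClass_comp hS hS', hr'.extClass_comp hS₁ hS', Ext.comp_mk₀_id]
    refine Eq.trans ?_ hζ
    rw [Ext.comp_assoc_of_second_deg_zero, Ext.mk₀_comp_mk₀]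
  obtain ⟨c, hc⟩ := exists_eq_comp_add hS' _ _ h
  refine ⟨N', P', i', p', w', hS', n ≫ a, (r' + c ≫ β) ≫ kernel.ι D, ?_, ?_, ?_⟩
  · change (n ≫ a) ≫ D = _
    have hl : n' ≫ β = i' ≫ r' := hr'.fac_left
    have hl' : (n ≫ a) ≫ e = i' ≫ (r' + c ≫ β) := by
      rw [← hπ, Preadditive.comp_add, ← hl, ← Category.assoc, ← Category.assoc i',
        ← Preadditive.add_comp, add_comm, Category.assoc n, hc, Category.comp_id]
    exact (congrArg ((n ≫ a) ≫ ·) he.symm).trans ((Category.assoc _ _ _).symm.trans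
      ((congrArg (· ≫ kernel.ι D) hl').trans (Category.assoc _ _ _)))
  · rw [Category.assoc]
    exact (congrArg (_ ≫ ·) (kernel.condition D)).trans comp_zero
  · have hl : r' ≫ kernel.ι D ≫ t = p' := hr'.fac_right
    change ((r' + c ≫ β) ≫ kernel.ι D) ≫ t = p'
    rw [Category.assoc, Preadditive.add_comp, hl, Category.assoc, kernel.condition, comp_zero,
      add_zero]

variable [MorphismProperty.HasLocalization.{w'} (HomologicalComplex.quasiIso A oneShape)]

lemma exists_hasRepr_comp_eq (hHered : ∀ X Y : A, Subsingleton (Ext.{w} X Y 2)) {X Y : A}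
    (f : QD.obj (stalkC X) ⟶ QD.obj (stalkC Y)) :
    ∃ (α : QD.obj (stalkC X) ⟶ QD.obj (stalkC X)) (β : QD.obj (stalkC X) ⟶ QD.obj (stalkC Y)),
      HasRepr α ∧ HasRepr β ∧ IsIso α ∧ α ≫ f = β := by
  obtain ⟨Z, s, g, hs, hf⟩ := exists_roof f
  obtain ⟨N, P, i, p, w, hS, a, b, h₁, h₂, h₃⟩ := exists_extC_refinement hHered s hs
  have hb : i ≫ b ≫ g.f () = 0 := by
    rw [← Category.assoc, ← h₁, Category.assoc, ← g.comm () ()]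
    exact (congrArg (a ≫ ·) comp_zero).trans comp_zero
  have hs' := extDesc_comp_stalk a b h₁ h₂ s _ p w rfl h₃
  have hg' := extDesc_comp_stalk a b h₁ h₂ g _ _ hb rfl rfl
  have := isIso_QD_map (quasiIso_extDescStalk hS 0)
  have hi := isIso_QD_map (quasiIso_extDescStalk hS (a ≫ s.f ()))
  refine ⟨inv (QD.map (extDescStalk 0 p w)) ≫ QD.map (extDescStalk (a ≫ s.f ()) p w),
    inv (QD.map (extDescStalk 0 p w)) ≫ QD.map (extDescStalk (a ≫ g.f ()) (b ≫ g.f ()) hb),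
    hasRepr_of_comp hS _ _ _ (IsIso.hom_inv_id_assoc _ _),
    hasRepr_of_comp hS _ _ _ (IsIso.hom_inv_id_assoc _ _), inferInstance, ?_⟩
  refine (Category.assoc _ _ _).trans (congrArg (_ ≫ ·) ?_)
  refine (congrArg (QD.map · ≫ f) hs'.symm).trans (Eq.trans ?_ (congrArg QD.map hg'))
  rw [Functor.map_comp, Functor.map_comp, Category.assoc, hf]

/-- Finiteness of the morphism spaces between stalk complexes in the derived category. -/
lemma finite_hom_stalkC (hHered : ∀ X Y : A, Subsingleton (Ext.{w} X Y 2)) (X Y : A)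
    [Finite (X ⟶ X)] [Finite (X ⟶ Y)] [Finite (Ext.{w} X X 1)] [Finite (Ext.{w} X Y 1)] :
    Finite (QD.obj (stalkC X) ⟶ QD.obj (stalkC Y)) := by
  choose α β hα hβ hi h using
    fun f : QD.obj (stalkC X) ⟶ QD.obj (stalkC Y) => exists_hasRepr_comp_eq hHered f
  have := finite_hasRepr X X
  have := finite_hasRepr X Y
  refine Finite.of_injective (fun f =>
    ((⟨α f, hα f⟩, ⟨β f, hβ f⟩) : {φ : QD.obj (stalkC X) ⟶ QD.obj (stalkC X) // HasRepr φ} ×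
      {φ : QD.obj (stalkC X) ⟶ QD.obj (stalkC Y) // HasRepr φ})) fun f f' e => ?_
  obtain ⟨e₁, e₂⟩ := Prod.ext_iff.1 e
  have e₁' : α f = α f' := congrArg Subtype.val e₁
  have e₂' : β f = β f' := congrArg Subtype.val e₂
  have := hi f
  rw [← cancel_epi (α f), h, e₂', e₁', h]

end OnePeriodic

namespace OnePeriodic

lemma div_mul_sqrt_inv_div_inv {c a y m : ℝ} (hy : 0 < y) :
    c / a * √(m⁻¹ / y⁻¹) = c * √y / (a * √m) := by
  rw [inv_div_inv, Real.sqrt_div hy.le, div_mul_div_comm]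

variable {A : Type u} [Category.{v} A] [Abelian A] [HasExt.{w} A] [∀ X Y : A, Finite (X ⟶ Y)]
  [MorphismProperty.HasLocalization.{w'} (HomologicalComplex.quasiIso A oneShape)]

lemma finite_hom_QD_stalkC (hExtFin : ∀ X Y : A, Finite (Abelian.Ext.{w} X Y 1))
    (hHered : ∀ X Y : A, Subsingleton (Abelian.Ext.{w} X Y 2)) (X Y : A) :
    Finite (QD.obj (stalkC X) ⟶ QD.obj (stalkC Y)) :=
  have := hExtFin X X
  have := hExtFin X Y
  finite_hom_stalkC hHered X Y

lemma homD1Card_pos (hExtFin : ∀ X Y : A, Finite (Abelian.Ext.{w} X Y 1))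
    (hHered : ∀ X Y : A, Subsingleton (Abelian.Ext.{w} X Y 2)) (X Y : A) :
    (0 : ℝ) < homD1Card X Y :=
  have := finite_hom_QD_stalkC hExtFin hHered X Y
  Nat.cast_pos.2 Nat.card_pos

lemma autD1_pos (hExtFin : ∀ X Y : A, Finite (Abelian.Ext.{w} X Y 1))
    (hHered : ∀ X Y : A, Subsingleton (Abelian.Ext.{w} X Y 2)) (X : A) :
    (0 : ℝ) < autD1 X :=
  have := finite_hom_QD_stalkC hExtFin hHered X X
  have : Finite (Aut (QD.obj (stalkC X))) := Finite.of_injective Iso.hom fun _ _ h => Iso.ext h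
  Nat.cast_pos.2 Nat.card_pos

lemma derived_hall_number_symmetry (hExtFin : ∀ X Y : A, Finite (Abelian.Ext.{w} X Y 1))
    (hHered : ∀ X Y : A, Subsingleton (Abelian.Ext.{w} X Y 2)) (X Y M : A) :
    ((coneCount Y M X : ℝ) / (autD1 Y : ℝ)) * Real.sqrt (braceD Y M / braceD Y Y) =
      ((coneCount M X Y : ℝ) / (autD1 X : ℝ)) * Real.sqrt (braceD M X / braceD X X) := by
  have hf := finite_hom_QD_stalkC hExtFin hHered
  have := hf X X
  have := hf Y Y
  have := hf Y X
  have := hf Y M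
  have := hf M X
  have key : ((coneCount Y M X : ℝ) * autD1 X) * √(homD1Card Y Y * homD1Card M X) =
      (coneCount M X Y * autD1 Y) * √(homD1Card X X * homD1Card Y M) := by
    have := TriangleCount.card_mul_sqrt_eq (QD.obj (stalkC Y)) (QD.obj (stalkC M))
      (QD.obj (stalkC X)) (stalkShiftIsoD X) (stalkShiftIsoD Y)
    simp only [← isConeOf_iff] at this
    exact this
  have h := homD1Card_pos hExtFin hHered
  have ha := autD1_pos hExtFin hHered
  rw [Real.sqrt_mul (h Y Y).le, Real.sqrt_mul (h X X).le] at key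
  unfold braceD
  rw [div_mul_sqrt_inv_div_inv (h Y Y), div_mul_sqrt_inv_div_inv (h X X),
    div_eq_div_iff (mul_pos (ha Y) (Real.sqrt_pos.2 (h Y M))).ne'
      (mul_pos (ha X) (Real.sqrt_pos.2 (h M X))).ne']
  linear_combination key

lemma coneCount_eq_Gnum (hExtFin : ∀ X Y : A, Finite (Abelian.Ext.{w} X Y 1))
    (hHered : ∀ X Y : A, Subsingleton (Abelian.Ext.{w} X Y 2)) (X Y M : A) :
    ((coneCount M X Y : ℝ) / (autD1 X : ℝ)) * Real.sqrt (braceD M X / braceD X X) =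
      Gnum X Y M := by
  have key := derived_hall_number_symmetry hExtFin hHered Y M X
  have h := homD1Card_pos hExtFin hHered
  have ha := autD1_pos hExtFin hHered
  unfold Gnum
  unfold braceD at key ⊢
  rw [← mul_inv, ← mul_inv]
  rw [div_mul_sqrt_inv_div_inv (h M M), div_mul_sqrt_inv_div_inv (h Y Y),
    div_eq_div_iff (mul_pos (ha M) (Real.sqrt_pos.2 (h M X))).ne'
      (mul_pos (ha Y) (Real.sqrt_pos.2 (h X Y))).ne'] at key
  rw [div_mul_sqrt_inv_div_inv (h X X), div_mul_sqrt_inv_div_inv (mul_pos (h X X) (h Y Y)),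
    Real.sqrt_mul (h X X).le, Real.sqrt_mul (h X Y).le,
    div_eq_div_iff (mul_pos (ha X) (Real.sqrt_pos.2 (h M X))).ne'
      (mul_pos (mul_pos (ha X) (ha Y))
        (mul_pos (Real.sqrt_pos.2 (h X Y)) (Real.sqrt_pos.2 (h M M)))).ne']
  linear_combination (√(homD1Card X X : ℝ) * autD1 X) * key

end OnePeriodic

/-- **Statement 17**: the two expressions `(|(B,M)_A|/ã_B)√({B,M}/{B,B})` and
`(|(M,A)_B|/ã_A)√({M,A}/{A,A})` agree, and their common value `G_{AB}^M` satisfies the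
derived Riedtmann–Peng formula `G_{AB}^M = (ã_M |(A,B)_M|/(ã_A ã_B))√({A,B}{M,M}/({A,A}{B,B}))`
(the right-hand side being `Gnum A B M` by definition). -/
theorem derived_hall_number_symmetry_and_Riedtmann_Peng
    (k : Type) [Field k] [Fintype k]
    {A : Type u} [Category.{v} A] [Abelian A] [Linear k A] [EssentiallySmall.{v} A]
    [HasExt.{w} A] [∀ X Y : A, Finite (X ⟶ Y)]
    (hExtFin : ∀ X Y : A, Finite (Abelian.Ext X Y 1))
    (hHered : ∀ X Y : A, Subsingleton (Abelian.Ext X Y 2))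
    [MorphismProperty.HasLocalization.{w'} (HomologicalComplex.quasiIso A oneShape)]
    (X Y M : A) :
    ((coneCount Y M X : ℝ) / (autD1 Y : ℝ)) * Real.sqrt (braceD Y M / braceD Y Y) =
      ((coneCount M X Y : ℝ) / (autD1 X : ℝ)) * Real.sqrt (braceD M X / braceD X X) ∧
    ((coneCount Y M X : ℝ) / (autD1 Y : ℝ)) * Real.sqrt (braceD Y M / braceD Y Y) =
      Gnum X Y M :=
  ⟨OnePeriodic.derived_hall_number_symmetry hExtFin hHered X Y M,
    (OnePeriodic.derived_hall_number_symmetry hExtFin hHered X Y M).trans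
      (OnePeriodic.coneCount_eq_Gnum hExtFin hHered X Y M)⟩

end
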